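/- (Relation R5 of the intermediate Wakimoto realization.) For all 1 ≤ i, j ≤ n with (α_i|α_j) ≠ −1 (i.e. i = j or |i − j| ≥ 2) and all m, p ∈ ℤ, [ρ(E_i)_m, ρ(E_j)_p] = 0 and [ρ(F_i)_m, ρ(F_j)_p] = 0 as linear operators on ℂ[x] ⊗ ℂ[y]. -/

import Mathlib

open MvPolynomial

/-- The Cartan matrix of `sl(n+1, ℂ)` (indices `0, …, n-1` represent `1, …, n`). -/
def cartan (n : ℕ) (i j : Fin n) : ℤ :=
  if i = j then 2 else if (i : ℕ) + 1 = (j : ℕ) ∨ (j : ℕ) + 1 = (i : ℕ) then -1 else 0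

/-- The pairing `(α_i | α_{kl}) = Σ_{s=k}^{l} A_{is}` of a simple root with the positive
root `α_k + ⋯ + α_l`. -/
def pairRoot (n : ℕ) (i k l : Fin n) : ℤ :=
  ∑ s ∈ Finset.Icc k l, cartan n i s

/-- The matrix `𝔅_{ij} = (α_i|α_j)(γ² − δ_{i>r}δ_{j>r}(r+1) + (r/2)δ_{i,r+1}δ_{j,r+1})`. -/
noncomputable def Bmat (n r : ℕ) (γ : ℂ) (i j : Fin n) : ℂ :=
  (cartan n i j : ℂ) *
    (γ ^ 2 - (if r < (i : ℕ) + 1 ∧ r < (j : ℕ) + 1 then (r : ℂ) + 1 else 0)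
      + (if (i : ℕ) = r ∧ (j : ℕ) = r then (r : ℂ) / 2 else 0))

/-- Index type for the variables of `ℂ[x] ⊗ ℂ[y] ≅ ℂ[x, y]`:  left summands index the
variables `x_{ij,m}` (`1 ≤ i ≤ j ≤ n`, `m ∈ ℤ`; only indices with `i ≤ j` are used),
right summands index the variables `y_{i,m}` (`1 ≤ i ≤ n`, `m ≥ 1`). -/
abbrev Idx (n : ℕ) := (Fin n × Fin n × ℤ) ⊕ (Fin n × ℕ+)

/-- The Fock space `ℂ[x] ⊗ ℂ[y]`, realized as a polynomial ring in both families of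
variables. -/
abbrev PXY (n : ℕ) := MvPolynomial (Idx n) ℂ

/-- The oscillator operator `a_{ij,m} ⊗ 1`. -/
noncomputable def aOp (n r : ℕ) (i j : Fin n) (m : ℤ) : Module.End ℂ (PXY n) :=
  if 0 ≤ m ∧ (j : ℕ) + 1 ≤ r then (pderiv (Sum.inl (i, j, m))).toLinearMap
  else LinearMap.mulLeft ℂ (X (Sum.inl (i, j, m)))

/-- The oscillator operator `a*_{ij,m} ⊗ 1`. -/
noncomputable def aStar (n r : ℕ) (i j : Fin n) (m : ℤ) : Module.End ℂ (PXY n) :=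
  if m ≤ 0 ∧ (j : ℕ) + 1 ≤ r then LinearMap.mulLeft ℂ (X (Sum.inl (i, j, -m)))
  else - (pderiv (Sum.inl (i, j, -m))).toLinearMap

/-- The Heisenberg operator `1 ⊗ b_{i,m}`. -/
noncomputable def bOp (n : ℕ) (e : Fin n → Fin n → ℂ) (lam : Fin n → ℂ)
    (i : Fin n) (m : ℤ) : Module.End ℂ (PXY n) :=
  if hm : 0 < m then
    (m : ℂ) • ∑ k : Fin n, e i k • (pderiv (Sum.inr (k, (⟨m.toNat, by omega⟩ : ℕ+)))).toLinearMap
  else if hm' : m < 0 then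
    ∑ k : Fin n, e i k • LinearMap.mulLeft ℂ (X (Sum.inr (k, (⟨(-m).toNat, by omega⟩ : ℕ+))))
  else lam i • (1 : Module.End ℂ (PXY n))

/-- The normally ordered quadratic operator `N_{kl,m} = Σ_{q∈ℤ} :a_{kl,q} a*_{kl,m-q}:`
(pointwise `finsum`). -/
noncomputable def Nop (n r : ℕ) (k l : Fin n) (m : ℤ) (P : PXY n) : PXY n :=
  ∑ᶠ q : ℤ,
    if 0 ≤ q ∧ (l : ℕ) + 1 ≤ r then aStar n r k l (m - q) (aOp n r k l q P)
    else aOp n r k l q (aStar n r k l (m - q) P)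

/-- The operator `ℋ_{i,m} = Σ_{1 ≤ k ≤ l ≤ n} (α_i|α_{kl}) N_{kl,m}`. -/
noncomputable def Hcal (n r : ℕ) (i : Fin n) (m : ℤ) (P : PXY n) : PXY n :=
  ∑ k : Fin n, ∑ l : Fin n,
    if k ≤ l then (pairRoot n i k l : ℂ) • Nop n r k l m P else 0

/-- The quadratic operator `(a_{kl} a*_{k'l'})_m = Σ_{q∈ℤ} a_{kl,q} a*_{k'l',m-q}`. -/
noncomputable def pairOp (n r : ℕ) (k l k' l' : Fin n) (m : ℤ) (P : PXY n) : PXY n :=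
  ∑ᶠ q : ℤ, aOp n r k l q (aStar n r k' l' (m - q) P)

/-- `Σ_{k=1}^{i-1} (a_{k,i-1} a*_{k,i})_m`. -/
noncomputable def sumLow (n r : ℕ) (i : Fin n) (m : ℤ) (P : PXY n) : PXY n :=
  ∑ k : Fin n, if h : k < i then
    pairOp n r k (⟨(i : ℕ) - 1, by have := i.isLt; omega⟩ : Fin n) k i m P
  else 0

/-- `Σ_{k=i+1}^{n} (a_{i+1,k} a*_{i,k})_m`. -/
noncomputable def sumHigh (n r : ℕ) (i : Fin n) (m : ℤ) (P : PXY n) : PXY n :=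
  ∑ k : Fin n, if h : i < k then
    pairOp n r (⟨(i : ℕ) + 1, by have := k.isLt; have := Fin.lt_def.mp h; omega⟩ : Fin n)
      k i k m P
  else 0

/-- `Σ_{j=i+1}^{n} (a_{i,j} a*_{i+1,j})_m`, the quadratic part of `ρ(F_i)_m`. -/
noncomputable def sumF (n r : ℕ) (i : Fin n) (m : ℤ) (P : PXY n) : PXY n :=
  ∑ j : Fin n, if h : i < j then
    pairOp n r i j (⟨(i : ℕ) + 1, by have := j.isLt; have := Fin.lt_def.mp h; omega⟩ : Fin n)
      j m P
  else 0

/-- `a_{jl,q}` is an annihilation operator iff `q ≥ 0` and `l ≤ r`. -/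
def annAFlag (r : ℕ) {n : ℕ} (l : Fin n) (q : ℤ) : Bool :=
  decide (0 ≤ q ∧ (l : ℕ) + 1 ≤ r)

/-- `a*_{jl,q}` is an annihilation operator iff `q > 0` or `l > r`. -/
def annSFlag (r : ℕ) {n : ℕ} (l : Fin n) (q : ℤ) : Bool :=
  ! decide (q ≤ 0 ∧ (l : ℕ) + 1 ≤ r)

/-- Normally ordered product of three operators (each tagged with its annihilation flag):
annihilation operators are placed to the right of creation operators. -/
noncomputable def nord3 {n : ℕ} (f1 f2 f3 : Module.End ℂ (PXY n) × Bool) :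
    Module.End ℂ (PXY n) :=
  (([f1, f2, f3].filter fun p => !p.2).map Prod.fst).prod *
    (([f1, f2, f3].filter fun p => p.2).map Prod.fst).prod

/-- The mode of `:a*_{ii}(z) a_{kl}(z) a*_{kl}(z):` of `z`-degree `-m-1`. -/
noncomputable def cubic (n r : ℕ) (i k l : Fin n) (m : ℤ) (P : PXY n) : PXY n :=
  ∑ᶠ q : ℤ × ℤ,
    nord3 (aStar n r i i q.1, annSFlag r i q.1)
      (aOp n r k l q.2, annAFlag r l q.2)
      (aStar n r k l (m - q.1 - q.2), annSFlag r l (m - q.1 - q.2)) P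

/-- The mode `ρ(E_i)_m`, the coefficient of `z^{-m-1}` in
`E_i(z) = :a*_{ii}(Σ_{k<i} a_{k,i-1}a*_{k,i-1} − Σ_{k≤i} a_{ki}a*_{ki}):
+ Σ_{k>i} a_{i+1,k}a*_{ik} − Σ_{k<i} a_{k,i-1}a*_{ki} − a*_{ii} b_i
− (δ_{i>r}(r+1) + δ_{i≤r}(i+1) − γ²) ∂a*_{ii}`. -/
noncomputable def rhoE (n r : ℕ) (γ : ℂ) (e : Fin n → Fin n → ℂ) (lam : Fin n → ℂ)
    (i : Fin n) (m : ℤ) (P : PXY n) : PXY n :=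
  (∑ k : Fin n, if h : k < i then
      cubic n r i k (⟨(i : ℕ) - 1, by have := i.isLt; omega⟩ : Fin n) m P
    else 0)
  - (∑ k : Fin n, if k ≤ i then cubic n r i k i m P else 0)
  + sumHigh n r i m P
  - sumLow n r i m P
  - (∑ᶠ q : ℤ, aStar n r i i q (bOp n e lam i (m - q) P))
  - ((if r < (i : ℕ) + 1 then (r : ℂ) + 1 else 0)
      + (if (i : ℕ) + 1 ≤ r then ((i : ℕ) : ℂ) + 2 else 0) - γ ^ 2) •
      ((-(m : ℂ)) • aStar n r i i m P)

/-- The mode `ρ(H_i)_m = ℋ_{i,m} ⊗ 1 + 1 ⊗ b_{i,m}`. -/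
noncomputable def rhoH (n r : ℕ) (e : Fin n → Fin n → ℂ) (lam : Fin n → ℂ)
    (i : Fin n) (m : ℤ) (P : PXY n) : PXY n :=
  Hcal n r i m P + bOp n e lam i m P

/-- The mode `ρ(F_i)_m = a_{ii,m} ⊗ 1 + Σ_{j=i+1}^{n} (a_{ij} a*_{i+1,j})_m ⊗ 1`. -/
noncomputable def rhoF (n r : ℕ) (i : Fin n) (m : ℤ) (P : PXY n) : PXY n :=
  aOp n r i i m P + sumF n r i m P

section RingBracket

variable {A : Type*} [Ring A]

theorem Ring.bracket_add (x y z : A) : ⁅x, y + z⁆ = ⁅x, y⁆ + ⁅x, z⁆ := by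
  simp only [Ring.lie_def]; noncomm_ring

theorem Ring.add_bracket (x y z : A) : ⁅x + y, z⁆ = ⁅x, z⁆ + ⁅y, z⁆ := by
  simp only [Ring.lie_def]; noncomm_ring

theorem Ring.bracket_sub (x y z : A) : ⁅x, y - z⁆ = ⁅x, y⁆ - ⁅x, z⁆ := by
  simp only [Ring.lie_def]; noncomm_ring

theorem Ring.sub_bracket (x y z : A) : ⁅x - y, z⁆ = ⁅x, z⁆ - ⁅y, z⁆ := by
  simp only [Ring.lie_def]; noncomm_ring

theorem Ring.bracket_zero (x : A) : ⁅x, (0 : A)⁆ = 0 := by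
  simp [Ring.lie_def]

theorem Ring.zero_bracket (x : A) : ⁅(0 : A), x⁆ = 0 := by
  simp [Ring.lie_def]

theorem Ring.bracket_skew (x y : A) : -⁅y, x⁆ = ⁅x, y⁆ := by
  simp [Ring.lie_def]

theorem Ring.bracket_neg (x y : A) : ⁅x, -y⁆ = -⁅x, y⁆ := by
  simp only [Ring.lie_def]; noncomm_ring

theorem Ring.bracket_mul (x y z : A) : ⁅x, y * z⁆ = ⁅x, y⁆ * z + y * ⁅x, z⁆ := by
  simp only [Ring.lie_def]; noncomm_ring

theorem Ring.bracket_bracket (x y z : A) : ⁅⁅x, y⁆, z⁆ = ⁅x, ⁅y, z⁆⁆ - ⁅y, ⁅x, z⁆⁆ := by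
  simp only [Ring.lie_def]; noncomm_ring

theorem Ring.bracket_sum {ι : Type*} (s : Finset ι) (x : A) (f : ι → A) :
    ⁅x, ∑ k ∈ s, f k⁆ = ∑ k ∈ s, ⁅x, f k⁆ := by
  simp only [Ring.lie_def, Finset.mul_sum, Finset.sum_mul, Finset.sum_sub_distrib]

theorem Ring.sum_bracket {ι : Type*} (s : Finset ι) (x : A) (f : ι → A) :
    ⁅∑ k ∈ s, f k, x⁆ = ∑ k ∈ s, ⁅f k, x⁆ := by
  simp only [Ring.lie_def, Finset.mul_sum, Finset.sum_mul, Finset.sum_sub_distrib]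

theorem Ring.bracket_smul {R : Type*} [CommRing R] [Algebra R A] (c : R) (x y : A) :
    ⁅x, c • y⁆ = c • ⁅x, y⁆ := by
  simp [Ring.lie_def, smul_sub]

theorem Ring.smul_bracket {R : Type*} [CommRing R] [Algebra R A] (c : R) (x y : A) :
    ⁅c • x, y⁆ = c • ⁅x, y⁆ := by
  simp [Ring.lie_def, smul_sub]

theorem Ring.bracket_eq_zero_symm {x y : A} (h : ⁅x, y⁆ = 0) : ⁅y, x⁆ = 0 := by
  rw [← Ring.bracket_skew, h, neg_zero]

end RingBracket

section LocallyFiniteSums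

variable {V ι κ : Type*} [AddCommGroup V] [Module ℂ V]

/-- A family of operators is locally finite if each vector is killed by almost all members. -/
def LocFin (f : ι → Module.End ℂ V) : Prop :=
  ∀ v, (Function.support fun s => f s v).Finite

/-- The family `f` is locally finite with pointwise sum `A`. -/
structure HasOpSum (f : ι → Module.End ℂ V) (A : Module.End ℂ V) : Prop where
  locFin : LocFin f
  eq : ∀ v, ∑ᶠ s, f s v = A v

/-- The pointwise sum of a locally finite family (and `0` otherwise). -/
noncomputable def opSum (f : ι → Module.End ℂ V) : Module.End ℂ V := by
  classical
  exact if h : LocFin f then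
    { toFun := fun v => ∑ᶠ s, f s v
      map_add' := fun v w => by
        simp only [map_add]
        exact finsum_add_distrib (h v) (h w)
      map_smul' := fun c v => by
        simp only [map_smul, RingHom.id_apply]
        exact (smul_finsum' c (h v)).symm }
  else 0

theorem LocFin.hasOpSum {f : ι → Module.End ℂ V} (h : LocFin f) : HasOpSum f (opSum f) :=
  ⟨h, fun v => by simp [opSum, h]⟩

theorem HasOpSum.unique {f : ι → Module.End ℂ V} {A B : Module.End ℂ V}
    (hA : HasOpSum f A) (hB : HasOpSum f B) : A = B :=
  LinearMap.ext fun v => (hA.eq v).symm.trans (hB.eq v)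

theorem HasOpSum.congr {f g : ι → Module.End ℂ V} {A : Module.End ℂ V}
    (hA : HasOpSum f A) (h : ∀ s, g s = f s) : HasOpSum g A :=
  (funext h : g = f) ▸ hA

theorem HasOpSum.add {f g : ι → Module.End ℂ V} {A B : Module.End ℂ V}
    (hA : HasOpSum f A) (hB : HasOpSum g B) : HasOpSum (fun s => f s + g s) (A + B) where
  locFin v := ((hA.locFin v).union (hB.locFin v)).subset (Function.support_add _ _)
  eq v := by
    simp only [LinearMap.add_apply, ← hA.eq, ← hB.eq]
    exact finsum_add_distrib (hA.locFin v) (hB.locFin v)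

theorem HasOpSum.mul_left {f : ι → Module.End ℂ V} {A : Module.End ℂ V}
    (hA : HasOpSum f A) (B : Module.End ℂ V) : HasOpSum (fun s => B * f s) (B * A) where
  locFin v := (hA.locFin v).subset fun s hs h0 => hs (by simp [h0])
  eq v := by
    simp only [Module.End.mul_apply, ← hA.eq]
    exact (B.toAddMonoidHom.map_finsum (hA.locFin v)).symm

theorem HasOpSum.mul_right {f : ι → Module.End ℂ V} {A : Module.End ℂ V}
    (hA : HasOpSum f A) (B : Module.End ℂ V) : HasOpSum (fun s => f s * B) (A * B) where
  locFin v := hA.locFin (B v)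
  eq v := hA.eq (B v)

theorem HasOpSum.smul {f : ι → Module.End ℂ V} {A : Module.End ℂ V}
    (hA : HasOpSum f A) (c : ℂ) : HasOpSum (fun s => c • f s) (c • A) := by
  simpa using hA.mul_left (c • (1 : Module.End ℂ V))

theorem HasOpSum.neg {f : ι → Module.End ℂ V} {A : Module.End ℂ V}
    (hA : HasOpSum f A) : HasOpSum (fun s => -f s) (-A) := by
  simpa using hA.smul (-1)

theorem HasOpSum.sub {f g : ι → Module.End ℂ V} {A B : Module.End ℂ V}
    (hA : HasOpSum f A) (hB : HasOpSum g B) : HasOpSum (fun s => f s - g s) (A - B) := by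
  simpa [sub_eq_add_neg] using hA.add hB.neg

theorem HasOpSum.lie_left {f : ι → Module.End ℂ V} {A : Module.End ℂ V}
    (hA : HasOpSum f A) (B : Module.End ℂ V) : HasOpSum (fun s => ⁅B, f s⁆) ⁅B, A⁆ := by
  simpa [Ring.lie_def] using (hA.mul_left B).sub (hA.mul_right B)

theorem HasOpSum.lie_right {f : ι → Module.End ℂ V} {A : Module.End ℂ V}
    (hA : HasOpSum f A) (B : Module.End ℂ V) : HasOpSum (fun s => ⁅f s, B⁆) ⁅A, B⁆ := by
  simpa [Ring.lie_def] using (hA.mul_right B).sub (hA.mul_left B)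

theorem HasOpSum.comp_equiv {f : ι → Module.End ℂ V} {A : Module.End ℂ V}
    (hA : HasOpSum f A) (σ : κ ≃ ι) : HasOpSum (fun s => f (σ s)) A where
  locFin v := (hA.locFin v).preimage σ.injective.injOn
  eq v := (finsum_comp_equiv σ (f := fun s => f s v)).trans (hA.eq v)

theorem hasOpSum_single (s₀ : ι) {f : ι → Module.End ℂ V} (h : ∀ s, s ≠ s₀ → f s = 0) :
    HasOpSum f (f s₀) where
  locFin v := (Set.finite_singleton s₀).subset fun s hs => by
    by_contra hne
    exact hs (by simp [h s hne])
  eq v := finsum_eq_single _ _ fun s hs => by simp [h s hs]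

theorem hasOpSum_zero : HasOpSum (fun _ : ι => (0 : Module.End ℂ V)) 0 :=
  ⟨fun v => by simp [Function.support], fun v => by simp⟩

theorem hasOpSum_finsetSum {α : Type*} (S : Finset α) {f : α → ι → Module.End ℂ V}
    {A : α → Module.End ℂ V} (h : ∀ k ∈ S, HasOpSum (f k) (A k)) :
    HasOpSum (fun s => ∑ k ∈ S, f k s) (∑ k ∈ S, A k) := by
  classical
  induction S using Finset.induction_on with
  | empty => simpa using hasOpSum_zero
  | insert a S ha ih =>
    simp only [Finset.sum_insert ha]
    exact (h a (by simp)).add (ih fun k hk => h k (by simp [hk]))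

/-- A jointly summable family may be summed first along the second coordinate. -/
theorem HasOpSum.fiberwise {f : ι × κ → Module.End ℂ V} {A : Module.End ℂ V}
    {g : ι → Module.End ℂ V} (hA : HasOpSum f A)
    (hg : ∀ s, HasOpSum (fun t => f (s, t)) (g s)) : HasOpSum g A where
  locFin v := ((hA.locFin v).image Prod.fst).subset fun s hs => by
    by_contra hne
    refine hs ?_
    refine ((hg s).eq v).symm.trans ?_
    refine (finsum_congr fun t => ?_).trans finsum_zero
    by_contra h
    exact hne ⟨(s, t), h, rfl⟩
  eq v := by
    rw [← hA.eq v, finsum_curry _ (hA.locFin v)]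
    exact finsum_congr fun s => ((hg s).eq v).symm

theorem LocFin.hasOpSum_of_fiberwise {f : ι × κ → Module.End ℂ V} {A : Module.End ℂ V}
    {g : ι → Module.End ℂ V} (hf : LocFin f) (hg : ∀ s, HasOpSum (fun t => f (s, t)) (g s))
    (hA : HasOpSum g A) : HasOpSum f A := by
  rw [hA.unique (hf.hasOpSum.fiberwise hg)]
  exact hf.hasOpSum

theorem locFin_prod {f : ι × κ → Module.End ℂ V}
    (h₁ : ∀ v, ∃ S : Set ι, S.Finite ∧ ∀ s ∉ S, ∀ t, f (s, t) v = 0)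
    (h₂ : ∀ s, LocFin fun t => f (s, t)) : LocFin f := by
  intro v
  obtain ⟨S, hS, hzero⟩ := h₁ v
  refine (hS.biUnion fun s _ => (h₂ s v).image (Prod.mk s)).subset ?_
  rintro ⟨s, t⟩ hst
  have hs : s ∈ S := by
    by_contra hs
    exact hst (hzero s hs t)
  exact Set.mem_biUnion hs ⟨t, hst, rfl⟩

end LocallyFiniteSums

section Fields

variable {V : Type*} [AddCommGroup V] [Module ℂ V]

/-- Modes of large positive index kill any given vector. -/
def BddAboveModes (f : ℤ → Module.End ℂ V) : Prop :=
  ∀ v, ∃ N : ℤ, ∀ q, N < q → f q v = 0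

/-- Modes of large negative index kill any given vector. -/
def BddBelowModes (f : ℤ → Module.End ℂ V) : Prop :=
  ∀ v, ∃ N : ℤ, ∀ q, q < N → f q v = 0

/-- Finiteness condition on a family of modes: bounded above, and also bounded below
unless `T` holds. -/
structure Tame (T : Prop) (f : ℤ → Module.End ℂ V) : Prop where
  above : BddAboveModes f
  below : ¬ T → BddBelowModes f

theorem Tame.mono {T T' : Prop} (h : T → T') {f : ℤ → Module.End ℂ V} (hf : Tame T f) :
    Tame T' f :=
  ⟨hf.above, fun h' => hf.below fun hT => h' (h hT)⟩

theorem locFin_mul {f g : ℤ → Module.End ℂ V} (hfg : ∀ s t, ⁅f s, g t⁆ = 0)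
    (hf : BddAboveModes f) (hg : BddAboveModes g) (m : ℤ) :
    LocFin fun u => f u * g (m - u) := by
  intro v
  obtain ⟨N, hN⟩ := hf v
  obtain ⟨M, hM⟩ := hg v
  refine (Set.finite_Icc (m - M) N).subset fun u hu => ?_
  by_contra hu'
  refine hu ?_
  rcases lt_or_ge N u with h | h
  · have := hfg u (m - u)
    rw [Ring.lie_def, sub_eq_zero] at this
    simp [this, hN u h]
  · have : M < m - u := by
      by_contra h'
      exact hu' ⟨by omega, h⟩
    simp [hM _ this]

/-- The modes of the product of two (commuting) fields. -/
noncomputable def mulModes (f g : ℤ → Module.End ℂ V) (m : ℤ) : Module.End ℂ V :=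
  opSum fun u => f u * g (m - u)

theorem hasOpSum_mulModes {f g : ℤ → Module.End ℂ V} (hfg : ∀ s t, ⁅f s, g t⁆ = 0)
    (hf : BddAboveModes f) (hg : BddAboveModes g) (m : ℤ) :
    HasOpSum (fun u => f u * g (m - u)) (mulModes f g m) :=
  (locFin_mul hfg hf hg m).hasOpSum

theorem tame_mulModes {T : Prop} {f g : ℤ → Module.End ℂ V} (hfg : ∀ s t, ⁅f s, g t⁆ = 0)
    (hf : Tame T f) (hg : Tame T g) : Tame T (mulModes f g) := by
  have hcomm : ∀ s t v, f s (g t v) = g t (f s v) := fun s t v => by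
    have := hfg s t
    rw [Ring.lie_def, sub_eq_zero] at this
    exact congrArg (fun A : Module.End ℂ V => A v) this
  constructor
  · intro v
    obtain ⟨N, hN⟩ := hf.above v
    obtain ⟨M, hM⟩ := hg.above v
    refine ⟨N + M, fun q hq => ?_⟩
    rw [← (hasOpSum_mulModes hfg hf.above hg.above q).eq v]
    refine (finsum_congr fun u => ?_).trans finsum_zero
    rcases lt_or_ge N u with h | h
    · simp [hcomm, hN u h]
    · simp [hM (q - u) (by omega)]
  · intro hT v
    obtain ⟨N, hN⟩ := hf.below hT v
    obtain ⟨M, hM⟩ := hg.below hT v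
    refine ⟨N + M, fun q hq => ?_⟩
    rw [← (hasOpSum_mulModes hfg hf.above hg.above q).eq v]
    refine (finsum_congr fun u => ?_).trans finsum_zero
    rcases lt_or_ge u N with h | h
    · simp [hcomm, hN u h]
    · simp [hM (q - u) (by omega)]

/-- Ordered product: `A` is moved to the right when it is the `s`-th mode of an
annihilating half, i.e. when `0 ≤ s` and `T` holds. -/
noncomputable def ordMul (T : Prop) [Decidable T] (s : ℤ) (A B : Module.End ℂ V) :
    Module.End ℂ V :=
  if 0 ≤ s ∧ T then B * A else A * B

/-- Indicator of the annihilating half. -/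
def annInd (T : Prop) [Decidable T] (s : ℤ) : ℂ := if 0 ≤ s ∧ T then 1 else 0

variable {T : Prop} [Decidable T]

theorem ordMul_eq (s : ℤ) (A B : Module.End ℂ V) :
    ordMul T s A B = A * B - annInd T s • ⁅A, B⁆ := by
  unfold ordMul annInd
  split_ifs <;> simp [Ring.lie_def]

theorem ordMul_of_lie_eq_zero (s : ℤ) {A B : Module.End ℂ V} (h : ⁅A, B⁆ = 0) :
    ordMul T s A B = A * B := by
  rw [ordMul_eq, h, smul_zero, sub_zero]

theorem HasOpSum.ordMul_left {ι : Type*} {f : ι → Module.End ℂ V} {A : Module.End ℂ V}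
    (hA : HasOpSum f A) (s : ℤ) (B : Module.End ℂ V) :
    HasOpSum (fun t => ordMul T s B (f t)) (ordMul T s B A) := by
  unfold ordMul
  split_ifs
  exacts [hA.mul_right B, hA.mul_left B]

theorem HasOpSum.ordMul_right {ι : Type*} {f : ι → Module.End ℂ V} {A : Module.End ℂ V}
    (hA : HasOpSum f A) (s : ℤ) (B : Module.End ℂ V) :
    HasOpSum (fun t => ordMul T s (f t) B) (ordMul T s A B) := by
  unfold ordMul
  split_ifs
  exacts [hA.mul_left B, hA.mul_right B]

theorem lie_ordMul (X : Module.End ℂ V) (s : ℤ) (A B : Module.End ℂ V) :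
    ⁅X, ordMul T s A B⁆ = ordMul T s ⁅X, A⁆ B + ordMul T s A ⁅X, B⁆ := by
  unfold ordMul
  split_ifs <;> simp only [Ring.lie_def] <;> noncomm_ring

theorem locFin_ordMul_mul {y f g : ℤ → Module.End ℂ V} (hy : T → BddAboveModes y)
    (hfg : ∀ s t, ⁅f s, g t⁆ = 0) (hf : Tame T f) (hg : Tame T g) (m : ℤ) :
    LocFin fun q : ℤ × ℤ => ordMul T q.1 (y q.1) (f q.2 * g (m - q.1 - q.2)) := by
  have hcomm : ∀ s t v, f s (g t v) = g t (f s v) := fun s t v => by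
    have := hfg s t
    rw [Ring.lie_def, sub_eq_zero] at this
    exact congrArg (fun A : Module.End ℂ V => A v) this
  refine locFin_prod (fun v => ?_) fun s =>
    ((locFin_mul hfg hf.above hg.above (m - s)).hasOpSum.ordMul_left s (y s)).locFin
  obtain ⟨N, hN⟩ := hf.above v
  obtain ⟨M, hM⟩ := hg.above v
  by_cases hT : T
  · obtain ⟨L, hL⟩ := hy hT v
    refine ⟨Set.Icc (min 0 (m - N - M)) (max 0 L), Set.finite_Icc _ _, fun s hs t => ?_⟩
    rcases lt_or_ge s 0 with h0 | h0
    · rw [ordMul, if_neg (by omega)]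
      rcases lt_or_ge N t with h | h
      · simp [hcomm, hN t h]
      · have : M < m - s - t := by
          by_contra h'
          exact hs ⟨by omega, by omega⟩
        simp [hM _ this]
    · have : L < s := by
        by_contra h'
        exact hs ⟨by omega, by omega⟩
      simp [ordMul, h0, hT, hL s this]
  · obtain ⟨N', hN'⟩ := hf.below hT v
    obtain ⟨M', hM'⟩ := hg.below hT v
    refine ⟨Set.Icc (m - N - M) (m - N' - M'), Set.finite_Icc _ _, fun s hs t => ?_⟩
    rw [ordMul, if_neg (by tauto)]
    rcases lt_or_ge N t with h | h
    · simp [hcomm, hN t h]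
    rcases lt_or_ge t N' with h' | h'
    · simp [hcomm, hN' t h']
    rcases lt_or_ge M (m - s - t) with h1 | h1
    · simp [hM _ h1]
    rcases lt_or_ge (m - s - t) M' with h2 | h2
    · simp [hM' _ h2]
    exact absurd ⟨by omega, by omega⟩ hs

/-- The family of modes of the constant field `1`. -/
noncomputable def oneModes (u : ℤ) : Module.End ℂ V := if u = 0 then 1 else 0

theorem tame_oneModes {T : Prop} : Tame T (oneModes (V := V)) :=
  ⟨fun _ => ⟨0, fun q hq => by simp [oneModes, hq.ne']⟩,
    fun _ _ => ⟨0, fun q hq => by simp [oneModes, hq.ne]⟩⟩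

theorem lie_oneModes (A : Module.End ℂ V) (u : ℤ) : ⁅A, (oneModes u : Module.End ℂ V)⁆ = 0 := by
  unfold oneModes
  split_ifs <;> simp [Ring.lie_def]

theorem oneModes_lie (A : Module.End ℂ V) (u : ℤ) : ⁅(oneModes u : Module.End ℂ V), A⁆ = 0 := by
  rw [← Ring.bracket_skew, lie_oneModes, neg_zero]

/-- The modes `Σ_s :y_s f_{m-s}:`. -/
noncomputable def ordModes (T : Prop) [Decidable T] (y f : ℤ → Module.End ℂ V) (m : ℤ) :
    Module.End ℂ V :=
  opSum fun s => ordMul T s (y s) (f (m - s))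

theorem hasOpSum_ordModes {y f : ℤ → Module.End ℂ V} (hy : T → BddAboveModes y)
    (hf : Tame T f) (m : ℤ) :
    HasOpSum (fun s => ordMul T s (y s) (f (m - s))) (ordModes T y f m) := by
  refine LocFin.hasOpSum fun v => ?_
  refine ((locFin_ordMul_mul hy (fun s t => lie_oneModes (f s) t) hf tame_oneModes m v).image
    Prod.fst).subset fun s hs => ⟨(s, m - s), ?_, rfl⟩
  simpa [oneModes] using hs

theorem hasOpSum_ordModes_mul {y f g : ℤ → Module.End ℂ V} (hy : T → BddAboveModes y)
    (hfg : ∀ s t, ⁅f s, g t⁆ = 0) (hf : Tame T f) (hg : Tame T g) (m : ℤ) :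
    HasOpSum (fun q : ℤ × ℤ => ordMul T q.1 (y q.1) (f q.2 * g (m - q.1 - q.2)))
      (ordModes T y (mulModes f g) m) :=
  (locFin_ordMul_mul hy hfg hf hg m).hasOpSum_of_fiberwise
    (fun s => (hasOpSum_mulModes hfg hf.above hg.above (m - s)).ordMul_left s (y s))
    (hasOpSum_ordModes hy (tame_mulModes hfg hf hg) m)

theorem hasOpSum_annInd_sub (d : ℤ) (B : Module.End ℂ V) :
    HasOpSum (fun t => (annInd T t - annInd T (t + d)) • B)
      ((if T then -(d : ℂ) else 0) • B) := by
  by_cases hT : T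
  · simp only [annInd, hT, and_true, if_true]
    have key : HasOpSum (fun t => ((if 0 ≤ t then (1 : ℂ) else 0) -
        (if 0 ≤ t + d then 1 else 0)) • (1 : Module.End ℂ V)) ((-(d : ℂ)) • 1) := by
      induction d using Int.induction_on with
      | zero => simpa using hasOpSum_zero
      | succ k ih =>
        have h1 := hasOpSum_single (V := V) (-(k : ℤ) - 1)
          (f := fun t => (if t = -(k : ℤ) - 1 then (-1 : ℂ) else 0) • 1) (fun s hs => by simp [hs])
        have h2 := (ih.add h1).congr
          (g := fun t => ((if 0 ≤ t then (1 : ℂ) else 0) -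
            (if 0 ≤ t + ((k : ℤ) + 1) then 1 else 0)) • (1 : Module.End ℂ V)) (fun t => by
            rw [← add_smul]
            congr 1
            split_ifs <;> first | omega | norm_num)
        convert h2 using 1
        rw [if_pos rfl, ← add_smul]
        push_cast
        ring_nf
      | pred k ih =>
        have h1 := hasOpSum_single (V := V) (k : ℤ)
          (f := fun t => (if t = (k : ℤ) then (1 : ℂ) else 0) • 1) (fun s hs => by simp [hs])
        have h2 := (ih.add h1).congr
          (g := fun t => ((if 0 ≤ t then (1 : ℂ) else 0) -
            (if 0 ≤ t + (-(k : ℤ) - 1) then 1 else 0)) • (1 : Module.End ℂ V)) (fun t => by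
            rw [← add_smul]
            congr 1
            split_ifs <;> first | omega | norm_num)
        convert h2 using 1
        rw [if_pos rfl, ← add_smul]
        push_cast
        ring_nf
    simpa using key.mul_right B
  · simpa [annInd, hT] using hasOpSum_zero

end Fields

section FieldBrackets

variable {V : Type*} [AddCommGroup V] [Module ℂ V] {T : Prop} [Decidable T]

theorem HasOpSum.lie_eq_zero {ι : Type*} {f : ι → Module.End ℂ V} {A : Module.End ℂ V}
    (hA : HasOpSum f A) {B : Module.End ℂ V} (h : ∀ s, ⁅B, f s⁆ = 0) : ⁅B, A⁆ = 0 :=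
  (hA.lie_left B).unique (hasOpSum_zero.congr h)

theorem ordMul_lie (X : Module.End ℂ V) (s : ℤ) (A B : Module.End ℂ V) :
    ⁅ordMul T s A B, X⁆ = ordMul T s ⁅A, X⁆ B + ordMul T s A ⁅B, X⁆ := by
  unfold ordMul
  split_ifs <;> simp only [Ring.lie_def] <;> noncomm_ring

theorem ordMul_neg_left (s : ℤ) (A B : Module.End ℂ V) :
    ordMul T s (-A) B = -ordMul T s A B := by
  unfold ordMul
  split_ifs <;> simp

theorem lie_ordModes_tame {y f g g' : ℤ → Module.End ℂ V} (hy : T → BddAboveModes y)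
    (hf : Tame T f) (hfg : ∀ s t, ⁅f s, g t⁆ = 0) (hgf : ∀ s t, ⁅g' s, f t⁆ = 0)
    (hg' : BddAboveModes g') (hyg : ∀ s t, ⁅y s, g t⁆ = g' (t + s)) (m u : ℤ) :
    ⁅ordModes T y f m, g u⁆ = mulModes g' f (m + u) := by
  have h1 := ((hasOpSum_ordModes hy hf m).lie_right (g u)).comp_equiv (Equiv.subRight u)
  refine h1.unique ((hasOpSum_mulModes hgf hg' hf.above (m + u)).congr fun s => ?_)
  simp only [Equiv.subRight_apply]
  rw [ordMul_lie, hyg, hfg, ordMul_of_lie_eq_zero _ (hgf _ _),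
    show m - (s - u) = m + u - s by ring, show u + (s - u) = s by ring]
  simp [ordMul]

theorem lie_ordModes_y {y f f' : ℤ → Module.End ℂ V} (hy : T → BddAboveModes y)
    (hyy : ∀ s t, ⁅y s, y t⁆ = 0) (hf : Tame T f) (hf' : Tame T f')
    (hyf : ∀ s t, ⁅y s, f t⁆ = f' (t + s)) (m t : ℤ) :
    ⁅ordModes T y f m, y t⁆ = -ordModes T y f' (m + t) := by
  rw [← Ring.bracket_skew, neg_inj]
  refine ((hasOpSum_ordModes hy hf m).lie_left (y t)).unique
    ((hasOpSum_ordModes hy hf' (m + t)).congr fun s => ?_)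
  rw [lie_ordMul, hyy, hyf, show m - s + t = m + t - s by ring]
  simp [ordMul]

theorem ordMul_ordMul {Y a b c : Module.End ℂ V} (s t : ℤ) (hYb : ⁅Y, b⁆ = c)
    (hab : ⁅a, b⁆ = 0) (hac : ⁅a, c⁆ = 0) :
    ordMul T s (ordMul T t Y a) b =
      ordMul T t Y (a * b) + (annInd T t - annInd T s) • (a * c) := by
  have he : ⁅⁅Y, a⁆, b⁆ = 0 := by rw [Ring.bracket_bracket, hab, hYb, hac]; simp [Ring.bracket_zero]
  have h1 : ⁅Y * a, b⁆ = a * c := by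
    rw [← Ring.bracket_skew, Ring.bracket_mul, ← Ring.bracket_skew, ← Ring.bracket_skew b a, hab,
      hYb]
    rw [Ring.lie_def, sub_eq_zero] at hac
    simp [hac]
  rw [ordMul_eq s, ordMul_eq t, ordMul_eq t, Ring.sub_bracket, Ring.smul_bracket, he, h1,
    Ring.bracket_mul, hYb]
  simp only [sub_mul, smul_mul_assoc, mul_assoc, smul_zero, sub_zero, smul_add, sub_smul]
  abel

theorem hasOpSum_lie_ordModes_ordModes {y f f' : ℤ → Module.End ℂ V}
    (hy : T → BddAboveModes y) (hyy : ∀ s t, ⁅y s, y t⁆ = 0) (hf : Tame T f) (hf' : Tame T f')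
    (hff : ∀ s t, ⁅f s, f t⁆ = 0) (hf'f : ∀ s t, ⁅f' s, f t⁆ = 0)
    (hf'f' : ∀ s t, ⁅f' s, f' t⁆ = 0)
    (hyf : ∀ s t, ⁅y s, f t⁆ = f' (t + s)) (m p : ℤ) :
    HasOpSum (fun d : ℤ => (if T then (d : ℂ) else 0) • (f' (m + d) * f' (p - d)))
      ⁅ordModes T y f m, ordModes T y f p⁆ := by
  set R := mulModes f' f
  have hR : Tame T R := tame_mulModes hf'f hf' hf
  have hanom : LocFin fun d : ℤ => f' (m + d) * f' (p - d) := by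
    have := ((hasOpSum_mulModes hf'f' hf'.above hf'.above (m + p)).comp_equiv
      (Equiv.addLeft m)).locFin
    simp only [Equiv.coe_addLeft, show ∀ d, m + p - (m + d) = p - d from fun d => by ring] at this
    exact this
  have hA := (show LocFin fun d : ℤ =>
      (if T then (d : ℂ) else 0) • (f' (m + d) * f' (p - d)) from fun v =>
    (hanom v).subset fun d hd (h0 : (f' (m + d) * f' (p - d)) v = 0) => hd (by
      simp only [LinearMap.smul_apply, h0, smul_zero])).hasOpSum
  set A := opSum fun d : ℤ => (if T then (d : ℂ) else 0) • (f' (m + d) * f' (p - d))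
  -- the joint sum of the totally ordered terms
  have hG : HasOpSum (fun q : ℤ × ℤ =>
      ordMul T q.2 (y q.2) (f' (m + q.1 - q.2) * f (p - q.1))) (ordModes T y R (m + p)) := by
    let σ : ℤ × ℤ ≃ ℤ × ℤ :=
      { toFun := fun q => (q.2, m + q.1 - q.2)
        invFun := fun q => (q.1 + q.2 - m, q.1)
        left_inv := fun q => by ext <;> simp
        right_inv := fun q => by ext <;> simp }
    refine ((hasOpSum_ordModes_mul hy hf'f hf' hf (m + p)).comp_equiv σ).congr fun q => ?_
    simp only [σ, Equiv.coe_fn_mk]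
    rw [show m + p - q.2 - (m + q.1 - q.2) = p - q.1 by ring]
  -- the joint sum of the reordering terms
  have hH : HasOpSum (fun q : ℤ × ℤ => (annInd T q.2 - annInd T q.1) •
      (f' (m + q.1 - q.2) * f' (p - q.1 + q.2))) (-A) := by
    let σ : ℤ × ℤ ≃ ℤ × ℤ :=
      { toFun := fun q => (q.1 - q.2, q.2)
        invFun := fun q => (q.1 + q.2, q.2)
        left_inv := fun q => by ext <;> simp
        right_inv := fun q => by ext <;> simp }
    have hfib : ∀ d : ℤ, HasOpSum (fun t => (annInd T t - annInd T (t + d)) •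
        (f' (m + d) * f' (p - d)))
        ((if T then -(d : ℂ) else 0) • (f' (m + d) * f' (p - d))) :=
      fun d => hasOpSum_annInd_sub d _
    have hloc : LocFin fun q : ℤ × ℤ => (annInd T q.2 - annInd T (q.2 + q.1)) •
        (f' (m + q.1) * f' (p - q.1)) := by
      refine locFin_prod (fun v => ⟨_, hanom v, fun d hd t => ?_⟩) fun d => (hfib d).locFin
      have hd : (f' (m + d) * f' (p - d)) v = 0 := by simpa using hd
      simp only [LinearMap.smul_apply, hd, smul_zero]
    have hsum := hloc.hasOpSum_of_fiberwise hfib (hA.neg.congr fun d => by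
      split_ifs <;> simp)
    refine (hsum.comp_equiv σ).congr fun q => ?_
    simp only [σ, Equiv.coe_fn_mk]
    rw [show q.2 + (q.1 - q.2) = q.1 by ring, show m + (q.1 - q.2) = m + q.1 - q.2 by ring,
      show p - (q.1 - q.2) = p - q.1 + q.2 by ring]
  have hZ : HasOpSum (fun s => ordMul T s (ordModes T y f' (m + s)) (f (p - s)))
      (ordModes T y R (m + p) + -A) :=
    (hG.add hH).fiberwise fun s =>
      ((hasOpSum_ordModes hy hf' (m + s)).ordMul_right s (f (p - s))).congr fun t =>
        (ordMul_ordMul s t (hyf t (p - s)) (hf'f _ _) (hf'f' _ _)).symm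
  have hfin := (hZ.neg.add (hasOpSum_ordModes hy hR (m + p))).congr
    (g := fun s => ⁅ordModes T y f m, ordMul T s (y s) (f (p - s))⁆) fun s => by
      rw [lie_ordMul, lie_ordModes_y hy hyy hf hf' hyf,
        lie_ordModes_tame hy hf hff hf'f hf'.above hyf, show m + (p - s) = m + p - s by ring]
      rw [ordMul_neg_left]
  have := ((hasOpSum_ordModes hy hf p).lie_left (ordModes T y f m)).unique hfin
  rw [this]
  simpa using hA

theorem lie_ordModes_heisenberg {y x : ℤ → Module.End ℂ V}
    (hy : T → BddAboveModes y) (hyy : ∀ s t, ⁅y s, y t⁆ = 0) (hx : Tame T x)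
    (hxx : ∀ s t, ⁅x s, x t⁆ = 0) (hyx : ∀ s t, ⁅y s, x t⁆ = oneModes (t + s)) (m p : ℤ) :
    ⁅ordModes T y x m, ordModes T y x p⁆ =
      (if T then -(m : ℂ) else 0) • (oneModes (p + m) : Module.End ℂ V) := by
  have h := hasOpSum_lie_ordModes_ordModes hy hyy hx tame_oneModes hxx
    (fun s t => oneModes_lie _ _) (fun s t => oneModes_lie _ _) hyx m p
  rw [h.unique (hasOpSum_single (-m) fun d hd => ?_)]
  · simp [oneModes]
  · simp [oneModes, show m + d ≠ 0 by omega]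

theorem hasOpSum_linear_mul {x : ℤ → Module.End ℂ V} (hx : BddAboveModes x)
    (hxx : ∀ s t, ⁅x s, x t⁆ = 0) (c : ℂ) (M : ℤ) :
    HasOpSum (fun u : ℤ => ((u : ℂ) - c) • (x u * x (M - u)))
      (((M : ℂ) / 2 - c) • mulModes x x M) := by
  have hQ := hasOpSum_mulModes hxx hx hx M
  have hZ := (show LocFin fun u : ℤ => (u : ℂ) • (x u * x (M - u)) from fun v =>
    (hQ.locFin v).subset fun d hd (h0 : (x d * x (M - d)) v = 0) => hd (by
      simp only [LinearMap.smul_apply, h0, smul_zero])).hasOpSum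
  set Z := opSum fun u : ℤ => (u : ℂ) • (x u * x (M - u))
  have hrev := hZ.comp_equiv (Equiv.subLeft M)
  have h2 : (M : ℂ) • mulModes x x M = Z + Z := by
    refine (hQ.smul (M : ℂ)).unique ((hZ.add hrev).congr fun u => ?_)
    have hc := hxx (M - u) u
    rw [Ring.lie_def, sub_eq_zero] at hc
    simp only [Equiv.subLeft_apply, show M - (M - u) = u by ring, hc, ← add_smul]
    push_cast
    ring_nf
  have h3 : ((M : ℂ) / 2 - c) • mulModes x x M = Z - c • mulModes x x M := by
    rw [sub_smul, div_eq_inv_mul, mul_smul, h2, ← two_smul ℂ Z, smul_smul]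
    norm_num
  rw [h3]
  exact (hZ.sub (hQ.smul c)).congr fun u => sub_smul _ _ _

theorem lie_mulModes_self {y x : ℤ → Module.End ℂ V} (hx : BddAboveModes x)
    (hxx : ∀ s t, ⁅x s, x t⁆ = 0) (hyx : ∀ s t, ⁅y s, x t⁆ = oneModes (t + s)) (s t : ℤ) :
    ⁅y s, mulModes x x t⁆ = (2 : ℂ) • x (t + s) := by
  have h1 := hasOpSum_single (V := V) (-s) (f := fun u => oneModes (u + s) * x (t - u))
    fun u hu => by simp [oneModes, show u + s ≠ 0 by omega]
  have h2 := hasOpSum_single (V := V) (t + s) (f := fun u => x u * oneModes (t - u + s))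
    fun u hu => by simp [oneModes, show t - u + s ≠ 0 by omega]
  refine ((hasOpSum_mulModes hxx hx hx t).lie_left (y s)).unique ?_
  convert (h1.add h2).congr fun u => ?_ using 1
  · simp [oneModes, two_smul]
  · rw [Ring.bracket_mul, hyx, hyx]

/-- Modes of `x K - :y x²: + D - c ∂x`. -/
noncomputable def raisingModes (T : Prop) [Decidable T] (x y K D : ℤ → Module.End ℂ V) (c : ℂ)
    (m : ℤ) : Module.End ℂ V :=
  mulModes x K m - ordModes T y (mulModes x x) m + D m + (c * m) • x m

theorem lie_raisingModes_eq_zero {x y K D : ℤ → Module.End ℂ V} {X : Module.End ℂ V}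
    (hx : Tame T x) (hy : T → BddAboveModes y) (hxx : ∀ s t, ⁅x s, x t⁆ = 0)
    (hxK : ∀ m, LocFin fun q => x q * K (m - q))
    (hXx : ∀ s, ⁅X, x s⁆ = 0) (hXy : ∀ s, ⁅X, y s⁆ = 0) (hXK : ∀ s, ⁅X, K s⁆ = 0)
    (hXD : ∀ s, ⁅X, D s⁆ = 0) (c : ℂ) (m : ℤ) : ⁅X, raisingModes T x y K D c m⁆ = 0 := by
  have hQ : ∀ s, ⁅X, mulModes x x s⁆ = 0 := fun s =>
    (hasOpSum_mulModes hxx hx.above hx.above s).lie_eq_zero fun u => by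
      simp [Ring.bracket_mul, hXx]
  have hW : ⁅X, ordModes T y (mulModes x x) m⁆ = 0 :=
    (hasOpSum_ordModes hy (tame_mulModes hxx hx hx) m).lie_eq_zero fun s => by
      rw [lie_ordMul, hXy, hQ]; simp [ordMul]
  have hM : ⁅X, mulModes x K m⁆ = 0 := (hxK m).hasOpSum.lie_eq_zero fun u => by
    simp [Ring.bracket_mul, hXx, hXK]
  simp [raisingModes, Ring.bracket_add, Ring.bracket_sub, Ring.bracket_smul, hM, hW, hXD, hXx]

theorem lie_raisingModes_self {x y K D G : ℤ → Module.End ℂ V} {κ c : ℂ}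
    (hx : Tame T x) (hy : T → BddAboveModes y) (hxx : ∀ s t, ⁅x s, x t⁆ = 0)
    (hyy : ∀ s t, ⁅y s, y t⁆ = 0) (hyx : ∀ s t, ⁅y s, x t⁆ = oneModes (t + s))
    (hxK : ∀ m, LocFin fun q => x q * K (m - q))
    (hKx : ∀ s t, ⁅K s, x t⁆ = 0) (hKy : ∀ s t, ⁅K s, y t⁆ = 0)
    (hKK : ∀ s t, ⁅K s, K t⁆ = (κ * s) • (oneModes (t + s) : Module.End ℂ V))
    (hDx : ∀ s t, ⁅D s, x t⁆ = 0) (hDy : ∀ s t, ⁅D s, y t⁆ = 0)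
    (hDD : ∀ s t, ⁅D s, D t⁆ = 0) (hKD : ∀ s t, ⁅K s, D t⁆ = G (s + t))
    (hκ : κ + 2 * c = if T then 4 else 0) (m p : ℤ) :
    ⁅raisingModes T x y K D c m, raisingModes T x y K D c p⁆ = 0 := by
  set Q := mulModes x x with hQdef
  set W := ordModes T y Q with hWdef
  set S := mulModes x K with hSdef
  have hQ : Tame T Q := tame_mulModes hxx hx hx
  have hQs := hasOpSum_mulModes hxx hx.above hx.above
  have hxQ : ∀ s t, ⁅x s, Q t⁆ = 0 := fun s t => (hQs t).lie_eq_zero fun u => by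
    simp [Ring.bracket_mul, hxx]
  have hQQ : ∀ s t, ⁅Q s, Q t⁆ = 0 := fun s t => (hQs t).lie_eq_zero fun u => by
    simp [Ring.bracket_mul, Ring.bracket_eq_zero_symm (hxQ _ _)]
  have h2x : Tame T fun s => (2 : ℂ) • x s :=
    ⟨fun v => (hx.above v).imp fun N h q hq => by simp [h q hq],
      fun hT v => (hx.below hT v).imp fun N h q hq => by simp [h q hq]⟩
  have hyQ := lie_mulModes_self hx.above hxx hyx
  have hS : ∀ m, HasOpSum (fun q => x q * K (m - q)) (S m) := fun m => (hxK m).hasOpSum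
  have hWs := hasOpSum_ordModes hy hQ
  have hWx : ∀ m p, ⁅W m, x p⁆ = Q (m + p) := fun m p => by
    rw [hWdef, lie_ordModes_tame hy hQ (fun s t => Ring.bracket_eq_zero_symm (hxQ t s))
      (fun s t => oneModes_lie _ _) (tame_oneModes (T := T)).above hyx]
    refine (hasOpSum_mulModes (fun s t => oneModes_lie _ _) (tame_oneModes (T := T)).above
      hQ.above (m + p)).unique ?_
    have h := hasOpSum_single (f := fun u => oneModes u * Q (m + p - u)) (0 : ℤ)
      fun u hu => by simp [oneModes, hu]
    simpa [oneModes] using h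
  have hWW : ⁅W m, W p⁆ = (if T then 2 * ((p : ℂ) - m) else 0) • Q (m + p) := by
    have h := hasOpSum_lie_ordModes_ordModes hy hyy hQ h2x hQQ
      (fun s t => by simp [Ring.smul_bracket, hxQ]) (fun s t => by simp [Ring.smul_bracket,
        Ring.bracket_smul, hxx]) hyQ m p
    refine h.unique ?_
    have h' := ((hasOpSum_linear_mul hx.above hxx (m : ℂ) (m + p)).comp_equiv
      (Equiv.addLeft m)).smul (if T then 4 else 0)
    convert h'.congr fun d => ?_ using 1
    · rw [smul_smul]
      congr 1
      split_ifs
      · push_cast; ring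
      · simp
    · simp only [Equiv.coe_addLeft, show m + p - (m + d) = p - d by ring, smul_mul_smul_comm,
        smul_smul]
      congr 1
      split_ifs
      · push_cast; ring
      · simp
  have hSx : ∀ m p, ⁅S m, x p⁆ = 0 := fun m p => Ring.bracket_eq_zero_symm <|
    (hS m).lie_eq_zero fun u => by simp [Ring.bracket_mul, hxx, Ring.bracket_eq_zero_symm (hKx _ _)]
  have hSK : ∀ m s, ⁅S m, K s⁆ = (-(κ * s)) • x (m + s) := fun m s => by
    rw [← Ring.bracket_skew, neg_smul, neg_inj]
    refine ((hS m).lie_left (K s)).unique ?_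
    convert hasOpSum_single (V := V) (m + s) fun u hu => ?_ using 1
    · simp [Ring.bracket_mul, hKx, hKK, oneModes]
    · simp [Ring.bracket_mul, hKx, hKK, oneModes, show m - u + s ≠ 0 by omega]
  have hSS : ⁅S m, S p⁆ = (κ * ((m : ℂ) - p) / 2) • Q (m + p) := by
    refine ((hS p).lie_left (S m)).unique ?_
    convert ((hasOpSum_linear_mul hx.above hxx (p : ℂ) (m + p)).smul κ).congr fun u => ?_ using 1
    · rw [smul_smul]
      congr 1
      push_cast
      ring
    · rw [Ring.bracket_mul, hSx, hSK, zero_mul, zero_add, mul_smul_comm, smul_smul,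
        show m + (p - u) = m + p - u by ring]
      congr 1
      push_cast
      ring
  have hWK : ∀ m s, ⁅W m, K s⁆ = 0 := fun m s => Ring.bracket_eq_zero_symm <|
    (hWs m).lie_eq_zero fun u => by
      have : ⁅K s, Q (m - u)⁆ = 0 := (hQs _).lie_eq_zero fun u => by simp [Ring.bracket_mul, hKx]
      rw [lie_ordMul, hKy, this]; simp [ordMul]
  have hWS' : ∀ m p, HasOpSum (fun q => Q q * K (m + p - q)) ⁅W m, S p⁆ := fun m p =>
    (((hS p).lie_left (W m)).comp_equiv (Equiv.subRight m)).congr fun q => by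
      simp only [Equiv.subRight_apply]
      rw [Ring.bracket_mul, hWx, hWK, mul_zero, add_zero, show m + (q - m) = q by ring,
        show p - (q - m) = m + p - q by ring]
  have hWS : ⁅W m, S p⁆ = ⁅W p, S m⁆ := (hWS' m p).unique (add_comm p m ▸ hWS' p m)
  have hSD' : ∀ m p, HasOpSum (fun q => x q * G (m + p - q)) ⁅S m, D p⁆ := fun m p =>
    ((hS m).lie_right (D p)).congr fun q => by
      rw [← Ring.bracket_skew, Ring.bracket_mul, hDx, zero_mul, zero_add, ← mul_neg,
        Ring.bracket_skew, hKD,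
        show m - q + p = m + p - q by ring]
  have hSD : ⁅S m, D p⁆ = ⁅S p, D m⁆ := (hSD' m p).unique (add_comm p m ▸ hSD' p m)
  have hDW : ∀ m p, ⁅D p, W m⁆ = 0 := fun m p =>
    (hWs m).lie_eq_zero fun u => by
      have : ⁅D p, Q (m - u)⁆ = 0 := (hQs _).lie_eq_zero fun u => by simp [Ring.bracket_mul, hDx]
      rw [lie_ordMul, hDy, this]; simp [ordMul]
  have hxW : ∀ m p, ⁅x p, W m⁆ = -Q (m + p) := fun m p => by rw [← Ring.bracket_skew, hWx]
  have hDS : ⁅D m, S p⁆ = -⁅S m, D p⁆ := by rw [← Ring.bracket_skew, hSD]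
  have hSW : ⁅S m, W p⁆ = -⁅W m, S p⁆ := by rw [← Ring.bracket_skew, hWS]
  simp only [raisingModes, Ring.bracket_add, Ring.add_bracket, Ring.bracket_sub, Ring.sub_bracket,
    Ring.bracket_smul, Ring.smul_bracket]
  simp only [← hQdef, ← hWdef, ← hSdef, hSS, hWW, hDS, hSW, hxW, hWx, hSx, hDW, hDD, hDx, hxx,
    Ring.bracket_eq_zero_symm (hDW _ _), Ring.bracket_eq_zero_symm (hSx _ _),
      Ring.bracket_eq_zero_symm (hDx _ _),
    add_comm p m]
  have hc : c = ((if T then 4 else 0) - κ) / 2 := by rw [← hκ]; ring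
  rw [hc]
  split_ifs <;> module

end FieldBrackets

section Heisenberg

variable {V : Type*} [AddCommGroup V] [Module ℂ V] {ι : Type*} [Fintype ι]

/-- The Heisenberg modes built from the derivations `D` and multiplications `M`. -/
noncomputable def heisenbergModes (D M : ι → ℤ → Module.End ℂ V) (e : ι → ℂ) (c : ℂ) (m : ℤ) :
    Module.End ℂ V :=
  if 0 < m then (m : ℂ) • ∑ k, e k • D k m
  else if m < 0 then ∑ k, e k • M k (-m) else c • 1

variable {D M : ι → ℤ → Module.End ℂ V}

theorem bddAboveModes_heisenbergModes (hD : ∀ k, BddAboveModes (D k)) (e : ι → ℂ) (c : ℂ) :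
    BddAboveModes (heisenbergModes D M e c) := by
  intro v
  choose N hN using fun k => hD k v
  refine ⟨∑ k, |N k|, fun q hq => ?_⟩
  have h0 : 0 < q := (Finset.sum_nonneg fun k _ => abs_nonneg (N k)).trans_lt hq
  have hz (k : ι) : D k q v = 0 := hN k q <| (le_abs_self (N k)).trans_lt <|
    (Finset.single_le_sum (fun k _ => abs_nonneg (N k)) (Finset.mem_univ k)).trans_lt hq
  simp [heisenbergModes, h0, hz, LinearMap.sum_apply]

theorem lie_heisenbergModes_eq_zero {Y : Module.End ℂ V} (hD : ∀ k m, ⁅Y, D k m⁆ = 0)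
    (hM : ∀ k m, ⁅Y, M k m⁆ = 0) (e : ι → ℂ) (c : ℂ) (m : ℤ) :
    ⁅Y, heisenbergModes D M e c m⁆ = 0 := by
  unfold heisenbergModes
  split_ifs
  · simp [Ring.bracket_smul, Ring.bracket_sum, hD]
  · simp [Ring.bracket_smul, Ring.bracket_sum, hM]
  · rw [Ring.bracket_smul, Ring.lie_def, mul_one, one_mul, sub_self, smul_zero]

theorem heisenbergModes_lie [DecidableEq ι] (hDD : ∀ k l s t, ⁅D k s, D l t⁆ = 0)
    (hMM : ∀ k l s t, ⁅M k s, M l t⁆ = 0)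
    (hDM : ∀ k l s t, 0 < s → 0 < t → ⁅D k s, M l t⁆ = if k = l ∧ s = t then 1 else 0)
    (e e' : ι → ℂ) (c c' : ℂ) (s t : ℤ) :
    ⁅heisenbergModes D M e c s, heisenbergModes D M e' c' t⁆ =
      (s * ∑ k, e k * e' k) • oneModes (t + s) := by
  have hcomm (Y : Module.End ℂ V) (c : ℂ) : ⁅Y, c • (1 : Module.End ℂ V)⁆ = 0 := by
    rw [Ring.bracket_smul, Ring.lie_def, mul_one, one_mul, sub_self, smul_zero]
  have hcomm' (Y : Module.End ℂ V) (c : ℂ) : ⁅c • (1 : Module.End ℂ V), Y⁆ = 0 :=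
    Ring.bracket_eq_zero_symm (hcomm Y c)
  unfold heisenbergModes
  split_ifs with hs ht ht' hs' ht ht' ht ht'
  · rw [oneModes, if_neg (by omega)]
    simp [Ring.bracket_smul, Ring.smul_bracket, Ring.bracket_sum, Ring.sum_bracket, hDD]
  · have h (k l : ι) : ⁅D k s, M l (-t)⁆ = if k = l then oneModes (t + s) else 0 := by
      rw [hDM k l s (-t) hs (by omega), oneModes, ite_and]
      congr 2
      exact propext (by omega)
    simp only [Ring.bracket_smul, Ring.smul_bracket, Ring.bracket_sum, Ring.sum_bracket, h,
      smul_ite, smul_zero, Finset.sum_ite_eq', Finset.mem_univ, if_true,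
      smul_smul, ← Finset.sum_smul]
    congr 1
    simp only [mul_comm (e' _), Finset.mul_sum, mul_assoc]
  · rw [hcomm, oneModes, if_neg (by omega), smul_zero]
  · have h (k l : ι) : ⁅M k (-s), D l t⁆ = if k = l then -oneModes (t + s) else 0 := by
      rw [← Ring.bracket_skew, hDM l k t (-s) ht (by omega), oneModes, ite_and]
      have : t = -s ↔ t + s = 0 := by omega
      simp only [this, eq_comm (a := l)]
      split_ifs <;> simp
    have hst : (s : ℂ) • (oneModes (t + s) : Module.End ℂ V) = (-t : ℂ) • oneModes (t + s) := by
      unfold oneModes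
      split_ifs with h0
      · rw [show s = -t by omega]; simp
      · simp
    rw [mul_comm, mul_smul, hst]
    simp only [Ring.bracket_smul, Ring.smul_bracket, Ring.bracket_sum, Ring.sum_bracket, h,
      smul_ite, smul_zero, Finset.sum_ite_eq', Finset.mem_univ, if_true, smul_smul, ←
        Finset.sum_smul, smul_neg, Finset.sum_neg_distrib]
    rw [← neg_smul]
    congr 1
    simp only [mul_comm (e' _), mul_comm _ (-(t : ℂ)), neg_mul]
  · rw [oneModes, if_neg (by omega)]
    simp [Ring.bracket_smul, Ring.smul_bracket, Ring.bracket_sum, Ring.sum_bracket, hMM]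
  · rw [hcomm, oneModes, if_neg (by omega), smul_zero]
  all_goals
    have : s = 0 := by omega
    simp [hcomm', this]

end Heisenberg

/-- Oscillators `a_{kl}`, `a*_{kl}` and Heisenberg fields `b_i` acting on a space `V`. -/
structure FreeFields (n r : ℕ) (V : Type*) [AddCommGroup V] [Module ℂ V] where
  /-- The modes of `a_{kl}`. -/
  a : Fin n → Fin n → ℤ → Module.End ℂ V
  /-- The modes of `a*_{kl}`. -/
  s : Fin n → Fin n → ℤ → Module.End ℂ V
  /-- The modes of `b_i`. -/
  b : Fin n → ℤ → Module.End ℂ V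
  /-- The form of the Heisenberg algebra. -/
  β : Fin n → Fin n → ℂ
  bdd_a : ∀ k (l : Fin n), (l : ℕ) + 1 ≤ r → BddAboveModes (a k l)
  tame_s : ∀ k (l : Fin n), Tame ((l : ℕ) + 1 ≤ r) (s k l)
  bdd_b : ∀ i, BddAboveModes (b i)
  a_lie_a : ∀ k l k' l' p q, ⁅a k l p, a k' l' q⁆ = 0
  s_lie_s : ∀ k l k' l' p q, ⁅s k l p, s k' l' q⁆ = 0
  a_lie_s : ∀ k l k' l' p q,
    ⁅a k l p, s k' l' q⁆ = if k = k' ∧ l = l' then oneModes (q + p) else 0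
  a_lie_b : ∀ k l i p q, ⁅a k l p, b i q⁆ = 0
  s_lie_b : ∀ k l i p q, ⁅s k l p, b i q⁆ = 0
  b_lie_b : ∀ i j p q, ⁅b i p, b j q⁆ = (p * β i j) • oneModes (q + p)

namespace FreeFields

variable {n r : ℕ} {V : Type*} [AddCommGroup V] [Module ℂ V] (W : FreeFields n r V)

/-- The operator `Σ_q :a_{kl,q} a*_{k'l',m-q}:`. -/
noncomputable def bil (k l k' l' : Fin n) (m : ℤ) : Module.End ℂ V :=
  ordModes ((l : ℕ) + 1 ≤ r) (W.a k l) (W.s k' l') m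

theorem hasOpSum_bil (k k' : Fin n) {l l' : Fin n} (h : l ≤ l') (m : ℤ) :
    HasOpSum (fun q => ordMul ((l : ℕ) + 1 ≤ r) q (W.a k l q) (W.s k' l' (m - q)))
      (W.bil k l k' l' m) :=
  hasOpSum_ordModes (W.bdd_a k l) ((W.tame_s k' l').mono fun h' =>
    (Nat.succ_le_succ (Fin.le_def.1 h)).trans h') m

theorem hasOpSum_bil_of_ne {k k' l l' : Fin n} (h : l ≤ l') (hne : ¬(k = k' ∧ l = l')) (m : ℤ) :
    HasOpSum (fun q => W.a k l q * W.s k' l' (m - q)) (W.bil k l k' l' m) :=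
  (W.hasOpSum_bil k k' h m).congr fun q =>
    (ordMul_of_lie_eq_zero q (by rw [W.a_lie_s, if_neg hne])).symm

theorem s_lie_a (k l k' l' : Fin n) (p q : ℤ) :
    ⁅W.s k l p, W.a k' l' q⁆ = if k = k' ∧ l = l' then -oneModes (p + q) else 0 := by
  rw [← Ring.bracket_skew, W.a_lie_s]
  simp only [eq_comm (a := k'), eq_comm (a := l')]
  split_ifs <;> simp

theorem bil_lie_a {k k' l l' : Fin n} (h : l ≤ l') (u v : Fin n) (m q : ℤ) :
    ⁅W.bil k l k' l' m, W.a u v q⁆ =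
      (if k' = u ∧ l' = v then (-1 : ℂ) else 0) • W.a k l (m + q) := by
  refine ((W.hasOpSum_bil k k' h m).lie_right (W.a u v q)).unique ?_
  have key (p : ℤ) : ⁅ordMul ((l : ℕ) + 1 ≤ r) p (W.a k l p) (W.s k' l' (m - p)), W.a u v q⁆ =
      (if k' = u ∧ l' = v then (-1 : ℂ) else 0) • if p = m + q then W.a k l p else 0 := by
    rw [ordMul_lie, W.a_lie_a, W.s_lie_a]
    by_cases hs : p = m + q
    · unfold ordMul
      split_ifs <;> simp [hs, oneModes]
    · have : m - p + q ≠ 0 := by omega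
      unfold ordMul
      split_ifs <;> simp [oneModes, this]
  have h0 := hasOpSum_single (f := fun p => (if k' = u ∧ l' = v then (-1 : ℂ) else 0) •
        if p = m + q then W.a k l p else 0) (m + q) fun p hp => by simp [hp]
  simpa using h0.congr key

theorem bil_lie_s {k k' l l' : Fin n} (h : l ≤ l') (u v : Fin n) (m q : ℤ) :
    ⁅W.bil k l k' l' m, W.s u v q⁆ =
      (if k = u ∧ l = v then (1 : ℂ) else 0) • W.s k' l' (m + q) := by
  refine ((W.hasOpSum_bil k k' h m).lie_right (W.s u v q)).unique ?_
  have key (p : ℤ) : ⁅ordMul ((l : ℕ) + 1 ≤ r) p (W.a k l p) (W.s k' l' (m - p)), W.s u v q⁆ =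
      (if k = u ∧ l = v then (1 : ℂ) else 0) • if p = -q then W.s k' l' (m - p) else 0 := by
    rw [ordMul_lie, W.s_lie_s, W.a_lie_s]
    by_cases hs : p = -q
    · unfold ordMul
      split_ifs <;> simp [hs, oneModes]
    · have : q + p ≠ 0 := by omega
      unfold ordMul
      split_ifs <;> simp [oneModes, this]
  have h0 := hasOpSum_single (f := fun p => (if k = u ∧ l = v then (1 : ℂ) else 0) •
        if p = -q then W.s k' l' (m - p) else 0) (-q) fun p hp => by simp [hp]
  simpa using h0.congr key

theorem lie_bil_eq_zero {k k' l l' : Fin n} (h : l ≤ l') {Y : Module.End ℂ V}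
    (ha : ∀ q, ⁅Y, W.a k l q⁆ = 0) (hs : ∀ q, ⁅Y, W.s k' l' q⁆ = 0) (m : ℤ) :
    ⁅Y, W.bil k l k' l' m⁆ = 0 :=
  (W.hasOpSum_bil k k' h m).lie_eq_zero fun q => by
    rw [lie_ordMul, ha, hs]
    simp [ordMul]

theorem lie_bil {k k' l l' u v u' v' : Fin n} {Y : Module.End ℂ V} {α α' : ℂ} {m : ℤ}
    (h : l ≤ l') (h₁ : v ≤ l') (h₂ : l ≤ v') (hne : ¬(k = k' ∧ l = l'))
    (hne₁ : ¬(u = k' ∧ v = l')) (hne₂ : ¬(k = u' ∧ l = v'))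
    (ha : ∀ q, ⁅Y, W.a k l q⁆ = α • W.a u v (m + q))
    (hs : ∀ q, ⁅Y, W.s k' l' q⁆ = α' • W.s u' v' (m + q)) (p : ℤ) :
    ⁅Y, W.bil k l k' l' p⁆ = α • W.bil u v k' l' (m + p) + α' • W.bil k l u' v' (m + p) := by
  refine ((W.hasOpSum_bil_of_ne h hne p).lie_left Y).unique ?_
  have e₁ := (W.hasOpSum_bil_of_ne h₁ hne₁ (m + p)).comp_equiv (Equiv.addLeft m)
  have e₂ := W.hasOpSum_bil_of_ne h₂ hne₂ (m + p)
  refine ((e₁.smul α).add (e₂.smul α')).congr fun q => ?_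
  rw [Ring.bracket_mul, ha, hs, Equiv.coe_addLeft, smul_mul_assoc, mul_smul_comm,
    show m + p - (m + q) = p - q by ring, show m + (p - q) = m + p - q by ring]

theorem bil_lie_b {k k' l l' : Fin n} (h : l ≤ l') (i : Fin n) (m p : ℤ) :
    ⁅W.bil k l k' l' m, W.b i p⁆ = 0 :=
  Ring.bracket_eq_zero_symm <| W.lie_bil_eq_zero h
    (fun _ => Ring.bracket_eq_zero_symm (W.a_lie_b _ _ _ _ _))
    (fun _ => Ring.bracket_eq_zero_symm (W.s_lie_b _ _ _ _ _)) m

/-- The index preceding `i` (or `0` if there is none). -/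
def predIdx (i : Fin n) : Fin n := ⟨(i : ℕ) - 1, by have := i.isLt; omega⟩

/-- The index following `i` (or `i` if there is none). -/
def succIdx (i : Fin n) : Fin n := if h : (i : ℕ) + 1 < n then ⟨(i : ℕ) + 1, h⟩ else i

@[simp] theorem predIdx_val (i : Fin n) : (predIdx i : ℕ) = i - 1 := rfl

theorem succIdx_val (i : Fin n) : (succIdx i : ℕ) = if (i : ℕ) + 1 < n then (i : ℕ) + 1 else i := by
  unfold succIdx
  split_ifs <;> rfl

/-- The weight of `a_{uv}` with respect to the `i`-th current. -/
def wt (i u v : Fin n) : ℂ :=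
  if u < i then (if i = v then 1 else 0) - (if predIdx i = v then 1 else 0) else 0

/-- The current `Σ_{k<i} (a_{k,i-1} a*_{k,i-1} - a_{ki} a*_{ki}) - b_i`. -/
noncomputable def current (i : Fin n) (m : ℤ) : Module.End ℂ V :=
  ∑ k : Fin n, (if k < i then W.bil k (predIdx i) k (predIdx i) m - W.bil k i k i m else 0) -
    W.b i m

theorem b_lie_a (i k l : Fin n) (p q : ℤ) : ⁅W.b i p, W.a k l q⁆ = 0 :=
  Ring.bracket_eq_zero_symm (W.a_lie_b k l i q p)

theorem b_lie_s (i k l : Fin n) (p q : ℤ) : ⁅W.b i p, W.s k l q⁆ = 0 :=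
  Ring.bracket_eq_zero_symm (W.s_lie_b k l i q p)

theorem b_lie_bil {k k' l l' : Fin n} (h : l ≤ l') (i : Fin n) (m p : ℤ) :
    ⁅W.b i p, W.bil k l k' l' m⁆ = 0 :=
  Ring.bracket_eq_zero_symm (W.bil_lie_b h i m p)

theorem current_lie_a (i u v : Fin n) (m q : ℤ) :
    ⁅W.current i m, W.a u v q⁆ = wt i u v • W.a u v (m + q) := by
  have key (k : Fin n) :
      ⁅if k < i then W.bil k (predIdx i) k (predIdx i) m - W.bil k i k i m else 0, W.a u v q⁆ =
        (if k = u then wt i u v else 0) • W.a u v (m + q) := by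
    by_cases hk : k < i
    · rw [if_pos hk, Ring.sub_bracket, W.bil_lie_a le_rfl, W.bil_lie_a le_rfl]
      by_cases hu : k = u
      · subst hu
        by_cases h1 : i = v <;> by_cases h2 : predIdx i = v <;>
          simp [h1, h2, hk, wt, sub_smul] <;> simp_all
      · simp [hu]
    · rw [if_neg hk, Ring.zero_bracket]
      split_ifs with hu
      · simp [wt, ← hu, hk]
      · simp
  rw [current, Ring.sub_bracket, b_lie_a, sub_zero, Ring.sum_bracket, Finset.sum_congr rfl
    fun k _ => key k, ← Finset.sum_smul, Finset.sum_ite_eq' _ _ fun _ => wt i u v]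
  simp

theorem current_lie_s (i u v : Fin n) (m q : ℤ) :
    ⁅W.current i m, W.s u v q⁆ = (-wt i u v) • W.s u v (m + q) := by
  have key (k : Fin n) :
      ⁅if k < i then W.bil k (predIdx i) k (predIdx i) m - W.bil k i k i m else 0, W.s u v q⁆ =
        (if k = u then -wt i u v else 0) • W.s u v (m + q) := by
    by_cases hk : k < i
    · rw [if_pos hk, Ring.sub_bracket, W.bil_lie_s le_rfl, W.bil_lie_s le_rfl]
      by_cases hu : k = u
      · subst hu
        by_cases h1 : i = v <;> by_cases h2 : predIdx i = v <;>
          simp [h1, h2, hk, wt, sub_smul] <;> simp_all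
      · simp [hu]
    · rw [if_neg hk, Ring.zero_bracket]
      split_ifs with hu
      · simp [wt, ← hu, hk]
      · simp
  rw [current, Ring.sub_bracket, b_lie_s, sub_zero, Ring.sum_bracket, Finset.sum_congr rfl
    fun k _ => key k, ← Finset.sum_smul, Finset.sum_ite_eq' _ _ fun _ => -wt i u v]
  simp

theorem number_lie_number (k l u v : Fin n) (m q : ℤ) :
    ⁅W.bil k l k l m, W.bil u v u v q⁆ =
      (if k = u ∧ l = v then (if (l : ℕ) + 1 ≤ r then -(m : ℂ) else 0) else 0) •
        oneModes (q + m) := by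
  split_ifs with h hr
  · obtain ⟨rfl, rfl⟩ := h
    rw [bil, bil, lie_ordModes_heisenberg (W.bdd_a k l) (fun _ _ => W.a_lie_a _ _ _ _ _ _)
      (W.tame_s k l) (fun _ _ => W.s_lie_s _ _ _ _ _ _) (fun _ _ => by simp [W.a_lie_s]),
      if_pos hr]
  · obtain ⟨rfl, rfl⟩ := h
    rw [bil, bil, lie_ordModes_heisenberg (W.bdd_a k l) (fun _ _ => W.a_lie_a _ _ _ _ _ _)
      (W.tame_s k l) (fun _ _ => W.s_lie_s _ _ _ _ _ _) (fun _ _ => by simp [W.a_lie_s]),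
      if_neg hr]
  · rw [zero_smul]
    exact W.lie_bil_eq_zero le_rfl (fun q => by rw [W.bil_lie_a le_rfl, if_neg h, zero_smul])
      (fun q => by rw [W.bil_lie_s le_rfl, if_neg h, zero_smul]) q

theorem current_lie_number (i u v : Fin n) (m q : ℤ) :
    ⁅W.current i m, W.bil u v u v q⁆ =
      (m * (wt i u v * if (v : ℕ) + 1 ≤ r then 1 else 0)) • oneModes (q + m) := by
  have key (k : Fin n) :
      ⁅if k < i then W.bil k (predIdx i) k (predIdx i) m - W.bil k i k i m else 0,
        W.bil u v u v q⁆ = (if k = u then m * (wt i u v * if (v : ℕ) + 1 ≤ r then 1 else 0) else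
          0) •
          oneModes (q + m) := by
    by_cases hk : k < i
    · rw [if_pos hk, Ring.sub_bracket, number_lie_number, number_lie_number, ← sub_smul]
      congr 1
      by_cases hu : k = u
      · subst hu
        have hne : i ≠ predIdx i := by
          rw [ne_eq, Fin.ext_iff, predIdx_val]
          have := Fin.lt_def.1 hk
          omega
        by_cases h2 : predIdx i = v
        · subst h2
          simp [hne, hk, wt]
        · by_cases h1 : i = v
          · subst h1
            by_cases h3 : (i : ℕ) < r <;> simp [h2, h3, hk, wt]
          · simp [h1, h2, hk, wt]
      · simp [hu]
    · rw [if_neg hk, Ring.zero_bracket]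
      by_cases hu : k = u
      · simp [wt, ← hu, hk]
      · rw [if_neg hu, zero_smul]
  rw [current, Ring.sub_bracket, W.b_lie_bil le_rfl, sub_zero, Ring.sum_bracket,
    Finset.sum_congr rfl fun k _ => key k, ← Finset.sum_smul, Finset.sum_ite_eq' _ _
    fun _ => (m * (wt i u v * if (v : ℕ) + 1 ≤ r then 1 else 0) : ℂ)]
  simp

/-- The level of the pairing of the `i`-th and `j`-th currents. -/
noncomputable def level (i j : Fin n) : ℂ :=
  W.β i j + ∑ k : Fin n, if k < j then
    (wt i k (predIdx j) * if (predIdx j : ℕ) + 1 ≤ r then 1 else 0) -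
      wt i k j * if (j : ℕ) + 1 ≤ r then 1 else 0
  else 0

theorem current_lie_b (i j : Fin n) (m q : ℤ) :
    ⁅W.current i m, W.b j q⁆ = -(m * W.β i j) • oneModes (q + m) := by
  rw [current, Ring.sub_bracket, W.b_lie_b, Ring.sum_bracket, Finset.sum_eq_zero, zero_sub,
    neg_smul]
  intro k _
  split_ifs
  · rw [Ring.sub_bracket, W.bil_lie_b le_rfl, W.bil_lie_b le_rfl, sub_zero]
  · exact Ring.zero_bracket _

theorem current_lie_current (i j : Fin n) (m q : ℤ) :
    ⁅W.current i m, W.current j q⁆ = (W.level i j * m) • oneModes (q + m) := by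
  nth_rewrite 2 [current]
  rw [Ring.bracket_sub, current_lie_b, Ring.bracket_sum, neg_smul, sub_neg_eq_add, level,
    add_comm, add_mul, add_smul, mul_comm (W.β i j), Finset.sum_mul, Finset.sum_smul]
  congr 1
  refine Finset.sum_congr rfl fun k _ => ?_
  by_cases hk : k < j
  · rw [if_pos hk, if_pos hk, Ring.bracket_sub, current_lie_number, current_lie_number, ← sub_smul]
    congr 1
    ring
  · rw [if_neg hk, if_neg hk, Ring.bracket_zero, zero_mul, zero_smul]

/-- The modes of `Σ_{k>i} a_{i+1,k} a*_{ik}`. -/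
noncomputable def high (i : Fin n) (m : ℤ) : Module.End ℂ V :=
  ∑ k : Fin n, if i < k then W.bil (succIdx i) k i k m else 0

/-- The modes of `Σ_{k<i} a_{k,i-1} a*_{ki}`. -/
noncomputable def low (i : Fin n) (m : ℤ) : Module.End ℂ V :=
  ∑ k : Fin n, if k < i then W.bil k (predIdx i) k i m else 0

theorem succIdx_val_of_lt {i k : Fin n} (h : i < k) : (succIdx i : ℕ) = i + 1 := by
  rw [succIdx_val, if_pos]
  have := Fin.lt_def.1 h
  omega

theorem succIdx_ne {i k : Fin n} (h : i < k) : succIdx i ≠ i := by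
  rw [ne_eq, Fin.ext_iff, succIdx_val_of_lt h]
  omega

theorem predIdx_le (i : Fin n) : predIdx i ≤ i := by
  rw [Fin.le_def, predIdx_val]
  omega

theorem predIdx_ne {i k : Fin n} (h : k < i) : predIdx i ≠ i := by
  rw [ne_eq, Fin.ext_iff, predIdx_val]
  have := Fin.lt_def.1 h
  omega

theorem lie_high_eq_zero {Y : Module.End ℂ V} {i : Fin n} {m : ℤ}
    (h : ∀ k, i < k → ⁅Y, W.bil (succIdx i) k i k m⁆ = 0) : ⁅Y, W.high i m⁆ = 0 := by
  rw [high, Ring.bracket_sum]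
  refine Finset.sum_eq_zero fun k _ => ?_
  split_ifs with hk
  exacts [h k hk, Ring.bracket_zero _]

theorem lie_low_eq_zero {Y : Module.End ℂ V} {i : Fin n} {m : ℤ}
    (h : ∀ k, k < i → ⁅Y, W.bil k (predIdx i) k i m⁆ = 0) : ⁅Y, W.low i m⁆ = 0 := by
  rw [low, Ring.bracket_sum]
  refine Finset.sum_eq_zero fun k _ => ?_
  split_ifs with hk
  exacts [h k hk, Ring.bracket_zero _]

theorem high_lie_a (i u v : Fin n) (m q : ℤ) :
    ⁅W.high i m, W.a u v q⁆ = (if i = u ∧ i < v then (-1 : ℂ) else 0) • W.a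
      (succIdx i) v (m + q) := by
  rw [high, Ring.sum_bracket, Finset.sum_eq_single v]
  · by_cases hv : i < v
    · rw [if_pos hv, W.bil_lie_a le_rfl]
      simp [hv]
    · simp [hv, Ring.zero_bracket]
  · intro k _ hk
    split_ifs
    · rw [W.bil_lie_a le_rfl, if_neg (fun h => hk h.2), zero_smul]
    · exact Ring.zero_bracket _
  · simp

theorem high_lie_s (i u v : Fin n) (m q : ℤ) :
    ⁅W.high i m, W.s u v q⁆ = (if succIdx i = u ∧ i < v then (1 : ℂ) else 0) • W.s i v (m + q) := by
  rw [high, Ring.sum_bracket, Finset.sum_eq_single v]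
  · by_cases hv : i < v
    · rw [if_pos hv, W.bil_lie_s le_rfl]
      simp [hv]
    · simp [hv, Ring.zero_bracket]
  · intro k _ hk
    split_ifs
    · rw [W.bil_lie_s le_rfl, if_neg (fun h => hk h.2), zero_smul]
    · exact Ring.zero_bracket _
  · simp

theorem low_lie_a (i u v : Fin n) (m q : ℤ) :
    ⁅W.low i m, W.a u v q⁆ = (if u < i ∧ i = v then (-1 : ℂ) else 0) • W.a
      u (predIdx i) (m + q) := by
  rw [low, Ring.sum_bracket, Finset.sum_eq_single u]
  · by_cases hu : u < i
    · rw [if_pos hu, W.bil_lie_a (predIdx_le i)]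
      simp [hu]
    · simp [hu, Ring.zero_bracket]
  · intro k _ hk
    split_ifs
    · rw [W.bil_lie_a (predIdx_le i), if_neg (fun h => hk h.1), zero_smul]
    · exact Ring.zero_bracket _
  · simp

theorem low_lie_s (i u v : Fin n) (m q : ℤ) :
    ⁅W.low i m, W.s u v q⁆ =
      (if u < i ∧ predIdx i = v then (1 : ℂ) else 0) • W.s u i (m + q) := by
  rw [low, Ring.sum_bracket, Finset.sum_eq_single u]
  · by_cases hu : u < i
    · rw [if_pos hu, W.bil_lie_s (predIdx_le i)]
      simp [hu]
    · simp [hu, Ring.zero_bracket]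
  · intro k _ hk
    split_ifs
    · rw [W.bil_lie_s (predIdx_le i), if_neg (fun h => hk h.1), zero_smul]
    · exact Ring.zero_bracket _
  · simp

variable {i j : Fin n}

theorem wt_diag (hij : (i : ℕ) + 1 ≠ j) : wt j i i = 0 := by
  unfold wt
  split_ifs with h₁ h₂ h₃ h₃ <;> simp only [Fin.ext_iff, Fin.lt_def, predIdx_val] at * <;>
    first | omega | simp

theorem wt_eq_zero (hne : i ≠ j) (hij : (j : ℕ) + 1 ≠ i) (k : Fin n) : wt i k j = 0 := by
  unfold wt
  split_ifs <;> simp only [ne_eq, Fin.ext_iff, Fin.lt_def, predIdx_val] at * <;>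
    first | omega | simp

theorem wt_predIdx_eq_zero (hne : i ≠ j) (hij : (i : ℕ) + 1 ≠ j) {k : Fin n} (hk : k < j) :
    wt i k (predIdx j) = 0 := by
  unfold wt
  split_ifs <;> simp only [ne_eq, Fin.ext_iff, Fin.lt_def, predIdx_val] at * <;>
    first | omega | simp

theorem current_lie_high (hij : (j : ℕ) + 1 ≠ i) (m q : ℤ) :
    ⁅W.current i m, W.high j q⁆ = 0 := by
  refine W.lie_high_eq_zero fun k hk => ?_
  have hne := succIdx_ne hk
  have hwt : wt i (succIdx j) k = wt i j k := by
    unfold wt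
    simp only [Fin.ext_iff, Fin.lt_def, predIdx_val, succIdx_val_of_lt hk] at *
    split_ifs <;> first | rfl | omega
  rw [W.lie_bil le_rfl le_rfl le_rfl (fun h => hne h.1) (fun h => hne h.1) (fun h => hne h.1)
    (fun q => W.current_lie_a i (succIdx j) k m q) (fun q => W.current_lie_s i j k m q), hwt,
    ← add_smul, add_neg_cancel, zero_smul]

theorem current_lie_low_term {k : Fin n} (hk : k < j) (i : Fin n) (m q : ℤ) :
    ⁅W.current i m, W.bil k (predIdx j) k j q⁆ =
      (wt i k (predIdx j) - wt i k j) • W.bil k (predIdx j) k j (m + q) := by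
  have hne := predIdx_ne hk
  rw [W.lie_bil (predIdx_le j) (predIdx_le j) (predIdx_le j) (fun h => hne h.2) (fun h => hne h.2)
    (fun h => hne h.2) (fun q => W.current_lie_a i k (predIdx j) m q)
    (fun q => W.current_lie_s i k j m q), ← add_smul, sub_eq_add_neg]

theorem current_lie_low (hne : i ≠ j) (hij : (j : ℕ) + 1 ≠ i) (hji : (i : ℕ) + 1 ≠ j) (m q : ℤ) :
    ⁅W.current i m, W.low j q⁆ = 0 := by
  refine W.lie_low_eq_zero fun k hk => ?_
  rw [W.current_lie_low_term hk, wt_predIdx_eq_zero hne hji hk, wt_eq_zero hne hij k, sub_zero,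
    zero_smul]

theorem current_lie_low_self (i : Fin n) (m q : ℤ) :
    ⁅W.current i m, W.low i q⁆ = (-2 : ℂ) • W.low i (m + q) := by
  rw [low, low, Ring.bracket_sum, Finset.smul_sum]
  refine Finset.sum_congr rfl fun k _ => ?_
  split_ifs with hk
  · have hne := predIdx_ne hk
    rw [W.current_lie_low_term hk]
    congr 1
    simp [wt, hk, hne, hne.symm]
    norm_num
  · rw [Ring.bracket_zero, smul_zero]

theorem high_lie_high (hij : (i : ℕ) + 1 ≠ j) (hji : (j : ℕ) + 1 ≠ i) (m q : ℤ) :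
    ⁅W.high i m, W.high j q⁆ = 0 := by
  refine W.lie_high_eq_zero fun k hk => W.lie_bil_eq_zero le_rfl (fun q => ?_) (fun q => ?_) q
  · rw [W.high_lie_a, if_neg, zero_smul]
    rw [Fin.ext_iff, succIdx_val_of_lt hk]
    omega
  · rw [W.high_lie_s, if_neg, zero_smul]
    rintro ⟨h₁, h₂⟩
    rw [Fin.ext_iff, succIdx_val_of_lt h₂] at h₁
    omega

theorem low_lie_low (hij : (i : ℕ) + 1 ≠ j) (hji : (j : ℕ) + 1 ≠ i) (m q : ℤ) :
    ⁅W.low i m, W.low j q⁆ = 0 := by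
  refine W.lie_low_eq_zero fun k hk =>
    W.lie_bil_eq_zero (predIdx_le j) (fun q => ?_) (fun q => ?_) q
  · rw [W.low_lie_a, if_neg, zero_smul]
    rw [Fin.ext_iff, predIdx_val]
    have := Fin.lt_def.1 hk
    omega
  · rw [W.low_lie_s, if_neg, zero_smul]
    rw [Fin.ext_iff, predIdx_val, Fin.lt_def]
    omega

theorem high_lie_low (hij : (i : ℕ) + 1 ≠ j) (m q : ℤ) : ⁅W.high i m, W.low j q⁆ = 0 := by
  rcases lt_or_ge i j with hlt | hge
  · have hlt' : (i : ℕ) + 1 < j := by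
      have := Fin.lt_def.1 hlt
      omega
    have hi : i < predIdx j := by
      rw [Fin.lt_def, predIdx_val]
      omega
    have hs : succIdx i < j := by
      rw [Fin.lt_def, succIdx_val_of_lt hlt]
      exact hlt'
    have hne := predIdx_ne hlt
    have key (k : Fin n) : ⁅W.high i m, if k < j then W.bil k (predIdx j) k j q else 0⁆ =
        ((if k = succIdx i then (1 : ℂ) else 0) - (if k = i then 1 else 0)) •
          W.bil (succIdx i) (predIdx j) i j (m + q) := by
      by_cases hk : k < j
      · rw [if_pos hk, W.lie_bil (predIdx_le j) (predIdx_le j) (predIdx_le j) (fun h => hne h.2)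
          (fun h => hne h.2) (fun h => hne h.2) (fun q => W.high_lie_a i k (predIdx j) m q)
          (fun q => W.high_lie_s i k j m q)]
        by_cases h₁ : k = i
        · subst h₁
          simp [hi, succIdx_ne hlt, (succIdx_ne hlt).symm]
        · by_cases h₂ : k = succIdx i
          · subst h₂
            simp [hlt, succIdx_ne hlt, (succIdx_ne hlt).symm]
          · simp [h₁, h₂, Ne.symm h₁, Ne.symm h₂]
      · have h₁ : k ≠ succIdx i := fun h => hk (h ▸ hs)
        have h₂ : k ≠ i := fun h => hk (h ▸ hlt)
        simp [hk, h₁, h₂, Ring.bracket_zero]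
    rw [low, Ring.bracket_sum, Finset.sum_congr rfl fun k _ => key k, ← Finset.sum_smul,
      Finset.sum_sub_distrib]
    simp
  · refine W.lie_low_eq_zero fun k hk =>
      W.lie_bil_eq_zero (predIdx_le j) (fun q => ?_) (fun q => ?_) q
    · rw [W.high_lie_a, if_neg, zero_smul]
      rintro ⟨rfl, -⟩
      exact hk.not_ge hge
    · rw [W.high_lie_s, if_neg, zero_smul]
      exact fun h => h.2.not_ge hge

/-- The modes of `Σ_{k>i} a_{i+1,k} a*_{ik} - Σ_{k<i} a_{k,i-1} a*_{ki}`. -/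
noncomputable def shift (i : Fin n) (m : ℤ) : Module.End ℂ V := W.high i m - W.low i m

theorem shift_lie_shift (hij : (i : ℕ) + 1 ≠ j) (hji : (j : ℕ) + 1 ≠ i) (m q : ℤ) :
    ⁅W.shift i m, W.shift j q⁆ = 0 := by
  rw [shift, shift, Ring.sub_bracket, Ring.bracket_sub, Ring.bracket_sub, W.high_lie_high hij hji,
    W.high_lie_low hij, W.low_lie_low hij hji, Ring.bracket_eq_zero_symm (W.high_lie_low hji q m)]
  simp

theorem current_lie_shift (hne : i ≠ j) (hij : (i : ℕ) + 1 ≠ j) (hji : (j : ℕ) + 1 ≠ i) (m q : ℤ) :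
    ⁅W.current i m, W.shift j q⁆ = 0 := by
  rw [shift, Ring.bracket_sub, W.current_lie_high hji, W.current_lie_low hne hji hij, sub_zero]

theorem current_lie_shift_self (i : Fin n) (m q : ℤ) :
    ⁅W.current i m, W.shift i q⁆ = (2 : ℂ) • W.low i (m + q) := by
  rw [shift, Ring.bracket_sub, W.current_lie_high (by omega), current_lie_low_self]
  simp

theorem current_lie_a_diag (hij : (i : ℕ) + 1 ≠ j) (m q : ℤ) :
    ⁅W.current j m, W.a i i q⁆ = 0 := by
  rw [current_lie_a, wt_diag hij, zero_smul]

theorem current_lie_s_diag (hij : (i : ℕ) + 1 ≠ j) (m q : ℤ) :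
    ⁅W.current j m, W.s i i q⁆ = 0 := by
  rw [current_lie_s, wt_diag hij, neg_zero, zero_smul]

theorem shift_lie_a_diag (i j : Fin n) (m q : ℤ) : ⁅W.shift j m, W.a i i q⁆ = 0 := by
  rw [shift, Ring.sub_bracket, high_lie_a, low_lie_a, if_neg, if_neg, zero_smul, zero_smul,
    sub_zero]
  · rintro ⟨h, rfl⟩
    exact h.ne rfl
  · rintro ⟨rfl, h⟩
    exact h.ne rfl

theorem shift_lie_s_diag (hij : (i : ℕ) + 1 ≠ j) (hji : (j : ℕ) + 1 ≠ i) (m q : ℤ) :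
    ⁅W.shift j m, W.s i i q⁆ = 0 := by
  rw [shift, Ring.sub_bracket, high_lie_s, low_lie_s, if_neg, if_neg, zero_smul, zero_smul,
    sub_zero]
  · rw [Fin.ext_iff, Fin.lt_def, predIdx_val]
    omega
  · rintro ⟨h, h'⟩
    rw [Fin.ext_iff, succIdx_val_of_lt h'] at h
    exact hji h

variable {i j : Fin n}

theorem hasOpSum_cubic {k l : Fin n} (hl : l ≤ i) (hne : ¬(k = i ∧ l = i)) (m : ℤ) :
    HasOpSum (fun q : ℤ × ℤ => ordMul ((l : ℕ) + 1 ≤ r) q.2 (W.a k l q.2)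
      (W.s i i q.1 * W.s k l (m - q.1 - q.2))) (mulModes (W.s i i) (W.bil k l k l) m) := by
  have hloc := locFin_ordMul_mul (W.bdd_a k l) (fun p q => W.s_lie_s i i k l p q)
    ((W.tame_s i i).mono fun h => (Nat.succ_le_succ (Fin.le_def.1 hl)).trans h) (W.tame_s k l) m
  have hsum := (hloc.hasOpSum.comp_equiv (Equiv.prodComm ℤ ℤ)).congr
    (g := fun q : ℤ × ℤ => ordMul ((l : ℕ) + 1 ≤ r) q.2 (W.a k l q.2)
      (W.s i i q.1 * W.s k l (m - q.1 - q.2))) fun q => by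
        simp only [Equiv.prodComm_apply, Prod.fst_swap, Prod.snd_swap, sub_right_comm m q.1]
  have hcomm (p q : ℤ) : W.a k l q * W.s i i p = W.s i i p * W.a k l q := by
    rw [← sub_eq_zero, ← Ring.lie_def, W.a_lie_s, if_neg hne]
  have hfib := hsum.fiberwise fun p => ((W.hasOpSum_bil k k (le_refl l) (m - p)).mul_left
    (W.s i i p)).congr fun q => by
      unfold ordMul
      split_ifs
      · rw [mul_assoc]
      · rw [← mul_assoc, hcomm, mul_assoc]
  rwa [hfib.unique hfib.locFin.hasOpSum] at hsum

theorem hasOpSum_mul_bil {k l : Fin n} (hl : l ≤ i) (hne : ¬(k = i ∧ l = i)) (m : ℤ) :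
    HasOpSum (fun q => W.s i i q * W.bil k l k l (m - q))
      (mulModes (W.s i i) (W.bil k l k l) m) := by
  have hcomm (p q : ℤ) : W.a k l q * W.s i i p = W.s i i p * W.a k l q := by
    rw [← sub_eq_zero, ← Ring.lie_def, W.a_lie_s, if_neg hne]
  exact (W.hasOpSum_cubic hl hne m).fiberwise fun p =>
    ((W.hasOpSum_bil k k (le_refl l) (m - p)).mul_left (W.s i i p)).congr fun q => by
      unfold ordMul
      split_ifs
      · rw [mul_assoc]
      · rw [← mul_assoc, hcomm, mul_assoc]

theorem hasOpSum_cubic_self (i : Fin n) (m : ℤ) :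
    HasOpSum (fun q : ℤ × ℤ => ordMul ((i : ℕ) + 1 ≤ r) q.2 (W.a i i q.2)
      (W.s i i q.1 * W.s i i (m - q.1 - q.2)))
      (ordModes ((i : ℕ) + 1 ≤ r) (W.a i i) (mulModes (W.s i i) (W.s i i)) m) :=
  ((hasOpSum_ordModes_mul (W.bdd_a i i) (fun p q => W.s_lie_s i i i i p q) (W.tame_s i i)
    (W.tame_s i i) m).comp_equiv (Equiv.prodComm ℤ ℤ)).congr fun q => by
      simp only [Equiv.prodComm_apply, Prod.fst_swap, Prod.snd_swap, sub_right_comm m q.1]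

theorem hasOpSum_mul_b (i : Fin n) (m : ℤ) :
    HasOpSum (fun q => W.s i i q * W.b i (m - q)) (mulModes (W.s i i) (W.b i) m) :=
  hasOpSum_mulModes (W.s_lie_b i i i) (W.tame_s i i).above (W.bdd_b i) m

theorem hasOpSum_mul_current (i : Fin n) (m : ℤ) :
    HasOpSum (fun q => W.s i i q * W.current i (m - q))
      (∑ k : Fin n, (if k < i then mulModes (W.s i i) (W.bil k (predIdx i) k (predIdx i)) m -
        mulModes (W.s i i) (W.bil k i k i) m else 0) - mulModes (W.s i i) (W.b i) m) := by
  have hk (k : Fin n) : HasOpSum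
      (fun q => W.s i i q * if k < i then W.bil k (predIdx i) k (predIdx i) (m - q) -
        W.bil k i k i (m - q) else 0)
      (if k < i then mulModes (W.s i i) (W.bil k (predIdx i) k (predIdx i)) m -
        mulModes (W.s i i) (W.bil k i k i) m else 0) := by
    split_ifs with h
    · refine ((W.hasOpSum_mul_bil (predIdx_le i) (fun h' => h.ne h'.1) m).sub
        (W.hasOpSum_mul_bil le_rfl (fun h' => h.ne h'.1) m)).congr fun q => ?_
      rw [mul_sub]
    · exact hasOpSum_zero.congr fun q => mul_zero _
  refine ((hasOpSum_finsetSum Finset.univ fun k _ => hk k).sub (W.hasOpSum_mul_b i m)).congr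
    fun q => ?_
  rw [current, mul_sub, Finset.mul_sum]

theorem high_apply (i : Fin n) (m : ℤ) (v : V) :
    W.high i m v = ∑ k : Fin n, if i < k then W.bil (succIdx i) k i k m v else 0 := by
  rw [high, LinearMap.sum_apply]
  refine Finset.sum_congr rfl fun k _ => ?_
  split_ifs <;> rfl

theorem low_apply (i : Fin n) (m : ℤ) (v : V) :
    W.low i m v = ∑ k : Fin n, if k < i then W.bil k (predIdx i) k i m v else 0 := by
  rw [low, LinearMap.sum_apply]
  refine Finset.sum_congr rfl fun k _ => ?_
  split_ifs <;> rfl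

/-- The modes of the raising field `E_i`. -/
noncomputable def raise (c : ℂ) (i : Fin n) : ℤ → Module.End ℂ V :=
  raisingModes ((i : ℕ) + 1 ≤ r) (W.s i i) (W.a i i) (W.current i) (W.shift i) c

theorem raise_apply (c : ℂ) (i : Fin n) (m : ℤ) (v : V) :
    W.raise c i m v =
      (∑ k : Fin n, if k < i then mulModes (W.s i i) (W.bil k (predIdx i) k (predIdx i)) m v
        else 0) -
      (∑ k : Fin n, if k ≤ i then (if k = i then
        ordModes ((i : ℕ) + 1 ≤ r) (W.a i i) (mulModes (W.s i i) (W.s i i)) m v else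
        mulModes (W.s i i) (W.bil k i k i) m v) else 0) +
      W.high i m v - W.low i m v - mulModes (W.s i i) (W.b i) m v -
      c • ((-(m : ℂ)) • W.s i i m v) := by
  have hle (k : Fin n) : (if k ≤ i then (if k = i then
        ordModes ((i : ℕ) + 1 ≤ r) (W.a i i) (mulModes (W.s i i) (W.s i i)) m v else
        mulModes (W.s i i) (W.bil k i k i) m v) else 0) =
      (if k < i then mulModes (W.s i i) (W.bil k i k i) m v else 0) + if k = i then
        ordModes ((i : ℕ) + 1 ≤ r) (W.a i i) (mulModes (W.s i i) (W.s i i)) m v else 0 := by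
    rcases lt_trichotomy k i with h | rfl | h
    · simp [h, h.le, h.ne]
    · simp
    · simp [h.not_ge, h.not_gt, h.ne']
  have hK := W.hasOpSum_mul_current i m
  have hite (k : Fin n) :
      (if k < i then mulModes (W.s i i) (W.bil k (predIdx i) k (predIdx i)) m -
        mulModes (W.s i i) (W.bil k i k i) m else 0) v =
      (if k < i then mulModes (W.s i i) (W.bil k (predIdx i) k (predIdx i)) m v else 0) -
        if k < i then mulModes (W.s i i) (W.bil k i k i) m v else 0 := by
    split_ifs <;> simp
  rw [raise, raisingModes, (show mulModes (W.s i i) (W.current i) m = _ from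
    hK.locFin.hasOpSum.unique hK)]
  simp only [hle, LinearMap.add_apply, LinearMap.sub_apply, LinearMap.sum_apply, hite,
    LinearMap.smul_apply, Finset.sum_add_distrib, Finset.sum_sub_distrib, shift]
  rw [Finset.sum_ite_eq' _ _ fun _ =>
    ordModes ((i : ℕ) + 1 ≤ r) (W.a i i) (mulModes (W.s i i) (W.s i i)) m v,
    if_pos (Finset.mem_univ i)]
  module

theorem lie_raise_eq_zero {Y : Module.End ℂ V} (hs : ∀ q, ⁅Y, W.s i i q⁆ = 0)
    (ha : ∀ q, ⁅Y, W.a i i q⁆ = 0) (hK : ∀ q, ⁅Y, W.current i q⁆ = 0)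
    (hD : ∀ q, ⁅Y, W.shift i q⁆ = 0) (c : ℂ) (m : ℤ) : ⁅Y, W.raise c i m⁆ = 0 :=
  lie_raisingModes_eq_zero (W.tame_s i i) (W.bdd_a i i) (fun _ _ => W.s_lie_s _ _ _ _ _ _)
    (fun m => (W.hasOpSum_mul_current i m).locFin) hs ha hK hD c m

theorem level_eq_zero (hne : i ≠ j) (hij : (i : ℕ) + 1 ≠ j) (hji : (j : ℕ) + 1 ≠ i)
    (hβ : W.β i j = 0) : W.level i j = 0 := by
  rw [level, hβ, zero_add]
  refine Finset.sum_eq_zero fun k _ => ?_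
  by_cases hk : k < j
  · rw [if_pos hk, wt_predIdx_eq_zero hne hij hk, wt_eq_zero hne hji k]
    ring
  · rw [if_neg hk]

theorem level_self (i : Fin n) : W.level i i = W.β i i -
    i * ((if (i : ℕ) ≤ r then 1 else 0) + if (i : ℕ) + 1 ≤ r then 1 else 0) := by
  have hcard : ((Finset.univ.filter fun k : Fin n => k < i).card : ℂ) = i := by
    rw [show (Finset.univ.filter fun k : Fin n => k < i) = Finset.Iio i by ext; simp, Fin.card_Iio]
  have hk (k : Fin n) : (if k < i then
      (wt i k (predIdx i) * if (predIdx i : ℕ) + 1 ≤ r then 1 else 0) -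
        wt i k i * if (i : ℕ) + 1 ≤ r then 1 else 0
      else 0) = if k < i then
        -((if (i : ℕ) ≤ r then (1 : ℂ) else 0) + if (i : ℕ) + 1 ≤ r then 1 else 0) else 0 := by
    by_cases h : k < i
    · have h₁ : (predIdx i : ℕ) + 1 = i := by
        rw [predIdx_val]
        have := Fin.lt_def.1 h
        omega
      rw [if_pos h, if_pos h, h₁]
      simp only [wt, h, if_true, predIdx_ne h, (predIdx_ne h).symm, if_false]
      ring
    · rw [if_neg h, if_neg h]
  rw [level, Finset.sum_congr rfl fun k _ => hk k, ← Finset.sum_filter, Finset.sum_const,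
    nsmul_eq_mul, hcard]
  ring

theorem raise_lie_raise (hne : i ≠ j) (hij : (i : ℕ) + 1 ≠ j) (hji : (j : ℕ) + 1 ≠ i)
    (hβ : W.β j i = 0) (c c' : ℂ) (m p : ℤ) : ⁅W.raise c i m, W.raise c' j p⁆ = 0 := by
  have hx (q : ℤ) : ⁅W.raise c i m, W.s j j q⁆ = 0 :=
    Ring.bracket_eq_zero_symm <| W.lie_raise_eq_zero (fun _ => W.s_lie_s _ _ _ _ _ _)
      (fun t => by rw [W.s_lie_a, if_neg fun h => hne h.1.symm])
      (fun t => Ring.bracket_eq_zero_symm (W.current_lie_s_diag hji t q))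
      (fun t => Ring.bracket_eq_zero_symm (W.shift_lie_s_diag hji hij t q)) c m
  have hy (q : ℤ) : ⁅W.raise c i m, W.a j j q⁆ = 0 :=
    Ring.bracket_eq_zero_symm <| W.lie_raise_eq_zero
      (fun t => by rw [W.a_lie_s, if_neg fun h => hne h.1.symm])
      (fun _ => W.a_lie_a _ _ _ _ _ _)
      (fun t => Ring.bracket_eq_zero_symm (W.current_lie_a_diag hji t q))
      (fun t => Ring.bracket_eq_zero_symm (W.shift_lie_a_diag j i t q)) c m
  refine W.lie_raise_eq_zero hx hy (fun q => ?_) (fun q => ?_) c' p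
  · refine Ring.bracket_eq_zero_symm <| W.lie_raise_eq_zero (W.current_lie_s_diag hij q)
      (W.current_lie_a_diag hij q) (fun t => ?_) (W.current_lie_shift hne.symm hji hij q) c m
    rw [W.current_lie_current, W.level_eq_zero hne.symm hji hij hβ, zero_mul, zero_smul]
  · refine Ring.bracket_eq_zero_symm <| W.lie_raise_eq_zero (W.shift_lie_s_diag hij hji q)
      (W.shift_lie_a_diag i j q) (fun t => ?_) (W.shift_lie_shift hji hij q) c m
    exact Ring.bracket_eq_zero_symm (W.current_lie_shift hne hij hji t q)

theorem raise_lie_raise_self {c : ℂ} (i : Fin n)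
    (hc : W.level i i + 2 * c = if (i : ℕ) + 1 ≤ r then 4 else 0) (m p : ℤ) :
    ⁅W.raise c i m, W.raise c i p⁆ = 0 :=
  lie_raisingModes_self (G := fun q => (2 : ℂ) • W.low i q) (W.tame_s i i) (W.bdd_a i i)
    (fun _ _ => W.s_lie_s _ _ _ _ _ _) (fun _ _ => W.a_lie_a _ _ _ _ _ _)
    (fun _ _ => by simp [W.a_lie_s]) (fun m => (W.hasOpSum_mul_current i m).locFin)
    (W.current_lie_s_diag (by omega)) (W.current_lie_a_diag (by omega))
    (W.current_lie_current i i) (W.shift_lie_s_diag (by omega) (by omega))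
    (W.shift_lie_a_diag i i) (W.shift_lie_shift (by omega) (by omega))
    (W.current_lie_shift_self i) hc m p

/-- The modes of the lowering field `F_i`. -/
noncomputable def lower (i : Fin n) (m : ℤ) : Module.End ℂ V :=
  W.a i i m + ∑ k : Fin n, if i < k then W.bil i k (succIdx i) k m else 0

theorem lower_apply (i : Fin n) (m : ℤ) (v : V) :
    W.lower i m v = W.a i i m v +
      ∑ k : Fin n, if i < k then W.bil i k (succIdx i) k m v else 0 := by
  rw [lower, LinearMap.add_apply, LinearMap.sum_apply]
  congr 1
  refine Finset.sum_congr rfl fun k _ => ?_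
  split_ifs <;> rfl

theorem lie_lower_eq_zero {Y : Module.End ℂ V} {m : ℤ} (ha : ⁅Y, W.a i i m⁆ = 0)
    (h : ∀ k, i < k → ⁅Y, W.bil i k (succIdx i) k m⁆ = 0) : ⁅Y, W.lower i m⁆ = 0 := by
  rw [lower, Ring.bracket_add, ha, zero_add, Ring.bracket_sum]
  refine Finset.sum_eq_zero fun k _ => ?_
  split_ifs with hk
  exacts [h k hk, Ring.bracket_zero _]

theorem lower_lie_lower (hij : (i : ℕ) + 1 ≠ j) (hji : (j : ℕ) + 1 ≠ i) (m p : ℤ) :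
    ⁅W.lower i m, W.lower j p⁆ = 0 := by
  have key {i j l : Fin n} (hij : (i : ℕ) + 1 ≠ j) (v : Fin n) (hl : i < l) (m q : ℤ) :
      ⁅W.bil i l (succIdx i) l m, W.a j v q⁆ = 0 := by
    rw [W.bil_lie_a le_rfl, if_neg, zero_smul]
    rw [Fin.ext_iff, succIdx_val_of_lt hl]
    omega
  have hbil {i j k l : Fin n} (hij : (i : ℕ) + 1 ≠ j) (hji : (j : ℕ) + 1 ≠ i)
      (hk : i < k) (hl : j < l) (m p : ℤ) :
      ⁅W.bil i k (succIdx i) k m, W.bil j l (succIdx j) l p⁆ = 0 := by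
    refine W.lie_bil_eq_zero le_rfl (key hij l hk m) (fun q => ?_) p
    rw [W.bil_lie_s le_rfl, if_neg, zero_smul]
    rw [Fin.ext_iff, succIdx_val_of_lt hl]
    omega
  refine W.lie_lower_eq_zero (Ring.bracket_eq_zero_symm ?_) fun l hl =>
    Ring.bracket_eq_zero_symm ?_
  · exact W.lie_lower_eq_zero (W.a_lie_a _ _ _ _ _ _) fun k hk =>
      Ring.bracket_eq_zero_symm (key hij j hk m p)
  · exact W.lie_lower_eq_zero (key hji i hl p m) fun k hk => hbil hji hij hl hk p m

end FreeFields

theorem Ring.neg_bracket {A : Type*} [Ring A] (x y : A) : ⁅-x, y⁆ = -⁅x, y⁆ := by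
  simp [Ring.lie_def, neg_add_eq_sub]

section MvPolynomialOperators

variable {σ : Type*}

theorem MvPolynomial.lie_pderiv_pderiv (s t : σ) :
    ⁅((pderiv (R := ℂ) s).toLinearMap : Module.End ℂ (MvPolynomial σ ℂ)), (pderiv (R := ℂ)
      t).toLinearMap⁆ = 0 := by
  classical
  have h (P : MvPolynomial σ ℂ) : pderiv s (pderiv t P) = pderiv t (pderiv s P) := by
    induction P using MvPolynomial.induction_on with
    | C a => simp
    | add p q hp hq => simp [hp, hq]
    | mul_X p u hp =>
      simp only [pderiv_mul, map_add, hp, pderiv_X, Pi.single_apply]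
      split_ifs <;> simp <;> ring
  refine LinearMap.ext fun P => ?_
  simp [Ring.lie_def, h]

theorem MvPolynomial.lie_mulLeft_mulLeft (P Q : MvPolynomial σ ℂ) :
    ⁅LinearMap.mulLeft ℂ P, LinearMap.mulLeft ℂ Q⁆ = 0 := by
  refine LinearMap.ext fun R => ?_
  simp [Ring.lie_def, mul_left_comm]

theorem MvPolynomial.lie_pderiv_mulLeft_X [DecidableEq σ] (s t : σ) :
    ⁅((pderiv (R := ℂ) s).toLinearMap : Module.End ℂ (MvPolynomial σ ℂ)), LinearMap.mulLeft ℂ (X t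
      : MvPolynomial σ ℂ)⁆ =
      if s = t then 1 else 0 := by
  refine LinearMap.ext fun R => ?_
  split_ifs with h
  · simp [Ring.lie_def, h]
  · simp [Ring.lie_def, pderiv_X_of_ne (Ne.symm h)]

theorem MvPolynomial.lie_mulLeft_X_pderiv [DecidableEq σ] (s t : σ) :
    ⁅LinearMap.mulLeft ℂ (X t : MvPolynomial σ ℂ), ((pderiv (R := ℂ) s).toLinearMap : Module.End ℂ
      (MvPolynomial σ ℂ))⁆ =
      -if s = t then 1 else 0 := by
  rw [← Ring.bracket_skew, lie_pderiv_mulLeft_X]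

theorem MvPolynomial.exists_bound_pderiv {ι : Type*} (f : ι → ℕ) {g : ι → σ}
    (hg : Function.Injective g) (P : MvPolynomial σ ℂ) :
    ∃ N : ℕ, ∀ q, N < f q → pderiv (g q) P = 0 := by
  classical
  refine ⟨(P.vars.preimage g hg.injOn).sup f, fun q hq => pderiv_eq_zero_of_notMem_vars ?_⟩
  intro h
  exact hq.not_ge (Finset.le_sup (f := f) (by simpa using h))

end MvPolynomialOperators

section Oscillators

variable {n r : ℕ}

theorem bddAboveModes_aOp {k l : Fin n} (h : (l : ℕ) + 1 ≤ r) : BddAboveModes (aOp n r k l) := by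
  intro P
  obtain ⟨N, hN⟩ := exists_bound_pderiv Int.natAbs
    (g := fun q : ℤ => (Sum.inl (k, l, q) : Idx n)) (fun _ _ h => by simpa using h) P
  exact ⟨N, fun q hq => by simpa [aOp, h, show 0 ≤ q by omega] using hN q (by omega)⟩

theorem tame_aStar (k l : Fin n) : Tame ((l : ℕ) + 1 ≤ r) (aStar n r k l) := by
  have key (P : PXY n) := exists_bound_pderiv Int.natAbs
    (g := fun q : ℤ => (Sum.inl (k, l, -q) : Idx n)) (fun _ _ h => by simpa using h) P
  refine ⟨fun P => (key P).elim fun N hN => ⟨N, fun q hq => ?_⟩,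
    fun h P => (key P).elim fun N hN => ⟨-N, fun q hq => ?_⟩⟩
  · simpa [aStar, show ¬ q ≤ 0 by omega] using hN q (by omega)
  · simpa [aStar, h] using hN q (by omega)

theorem aOp_lie_aOp (k l k' l' : Fin n) (s t : ℤ) : ⁅aOp n r k l s, aOp n r k' l' t⁆ = 0 := by
  unfold aOp
  split_ifs with h h' h'
  · exact lie_pderiv_pderiv _ _
  · rw [lie_pderiv_mulLeft_X, if_neg]
    rintro ⟨⟩
    exact h' h
  · rw [lie_mulLeft_X_pderiv, if_neg, neg_zero]
    rintro ⟨⟩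
    exact h h'
  · exact lie_mulLeft_mulLeft _ _

theorem aStar_lie_aStar (k l k' l' : Fin n) (s t : ℤ) :
    ⁅aStar n r k l s, aStar n r k' l' t⁆ = 0 := by
  unfold aStar
  split_ifs with h h' h'
  · exact lie_mulLeft_mulLeft _ _
  · rw [Ring.bracket_neg, lie_mulLeft_X_pderiv, if_neg, neg_zero, neg_zero]
    intro hs
    simp only [Sum.inl.injEq, Prod.mk.injEq, neg_inj] at hs
    obtain ⟨-, rfl, rfl⟩ := hs
    exact h' h
  · rw [Ring.neg_bracket, lie_pderiv_mulLeft_X, if_neg, neg_zero]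
    intro hs
    simp only [Sum.inl.injEq, Prod.mk.injEq, neg_inj] at hs
    obtain ⟨-, rfl, rfl⟩ := hs
    exact h h'
  · rw [Ring.neg_bracket, Ring.bracket_neg, lie_pderiv_pderiv, neg_zero, neg_zero]

theorem aOp_lie_aStar (k l k' l' : Fin n) (s t : ℤ) :
    ⁅aOp n r k l s, aStar n r k' l' t⁆ = if k = k' ∧ l = l' then oneModes (t + s) else 0 := by
  have key : (Sum.inl (k, l, s) : Idx n) = Sum.inl (k', l', -t) ↔
      (k = k' ∧ l = l') ∧ t + s = 0 := by
    simp only [Sum.inl.injEq, Prod.mk.injEq, and_assoc]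
    refine and_congr_right fun _ => and_congr_right fun _ => ?_
    omega
  have hite : (if k = k' ∧ l = l' then oneModes (t + s) else 0 : Module.End ℂ (PXY n)) =
      if (Sum.inl (k, l, s) : Idx n) = Sum.inl (k', l', -t) then 1 else 0 := by
    simp only [key, oneModes, ite_and]
  rw [hite]
  unfold aOp aStar
  by_cases hs : (Sum.inl (k, l, s) : Idx n) = Sum.inl (k', l', -t)
  · obtain ⟨⟨-, rfl⟩, hst⟩ := key.1 hs
    rw [if_pos hs]
    split_ifs
    · rw [lie_pderiv_mulLeft_X, if_pos hs]
    · omega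
    · omega
    · rw [Ring.bracket_neg, lie_mulLeft_X_pderiv, if_pos hs.symm, neg_neg]
  · rw [if_neg hs]
    split_ifs
    · rw [lie_pderiv_mulLeft_X, if_neg hs]
    · rw [Ring.bracket_neg, lie_pderiv_pderiv, neg_zero]
    · exact lie_mulLeft_mulLeft _ _
    · rw [Ring.bracket_neg, lie_mulLeft_X_pderiv, if_neg (mt Eq.symm hs), neg_zero, neg_zero]

end Oscillators

section HeisenbergOnPolynomials

variable {n : ℕ}

/-- The derivation with respect to `y_{k,m}`. -/
noncomputable def derivY (k : Fin n) (m : ℤ) : Module.End ℂ (PXY n) :=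
  if 0 < m then (pderiv (Sum.inr (k, m.toNat.toPNat'))).toLinearMap else 0

/-- The multiplication by `y_{k,m}`. -/
noncomputable def mulY (k : Fin n) (m : ℤ) : Module.End ℂ (PXY n) :=
  if 0 < m then LinearMap.mulLeft ℂ (X (Sum.inr (k, m.toNat.toPNat'))) else 0

theorem coe_toNat_toPNat' {m : ℤ} (h : 0 < m) : ((m.toNat.toPNat' : ℕ+) : ℕ) = m.toNat := by
  rw [Nat.toPNat'_coe, if_pos (by omega)]

theorem lie_derivY_eq_zero {Y : Module.End ℂ (PXY n)}
    (h : ∀ q : Fin n × ℕ+, ⁅Y, (pderiv (R := ℂ) (Sum.inr q : Idx n)).toLinearMap⁆ = 0)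
    (k : Fin n) (m : ℤ) : ⁅Y, derivY k m⁆ = 0 := by
  unfold derivY
  split_ifs
  exacts [h _, Ring.bracket_zero _]

theorem lie_mulY_eq_zero {Y : Module.End ℂ (PXY n)}
    (h : ∀ q : Fin n × ℕ+, ⁅Y, LinearMap.mulLeft ℂ (X (Sum.inr q) : PXY n)⁆ = 0)
    (k : Fin n) (m : ℤ) : ⁅Y, mulY k m⁆ = 0 := by
  unfold mulY
  split_ifs
  exacts [h _, Ring.bracket_zero _]

theorem bddAboveModes_derivY (k : Fin n) : BddAboveModes (derivY k) := by
  intro P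
  obtain ⟨N, hN⟩ := exists_bound_pderiv (fun q : ℕ+ => (q : ℕ))
    (g := fun q => (Sum.inr (k, q) : Idx n)) (fun _ _ h => by simpa using h) P
  refine ⟨N, fun q hq => ?_⟩
  have h : 0 < q := by omega
  rw [derivY, if_pos h]
  exact hN _ (by rw [coe_toNat_toPNat' h]; omega)

theorem derivY_lie_derivY (k l : Fin n) (s t : ℤ) : ⁅derivY k s, derivY l t⁆ = 0 :=
  lie_derivY_eq_zero (fun _ => Ring.bracket_eq_zero_symm <|
    lie_derivY_eq_zero (fun _ => lie_pderiv_pderiv _ _) k s) l t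

theorem mulY_lie_mulY (k l : Fin n) (s t : ℤ) : ⁅mulY k s, mulY l t⁆ = 0 :=
  lie_mulY_eq_zero (fun _ => Ring.bracket_eq_zero_symm <|
    lie_mulY_eq_zero (fun _ => lie_mulLeft_mulLeft _ _) k s) l t

theorem derivY_lie_mulY (k l : Fin n) (s t : ℤ) (hs : 0 < s) (ht : 0 < t) :
    ⁅derivY k s, mulY l t⁆ = if k = l ∧ s = t then 1 else 0 := by
  have hst : s.toNat.toPNat' = t.toNat.toPNat' ↔ s = t := by
    rw [← PNat.coe_inj, coe_toNat_toPNat' hs, coe_toNat_toPNat' ht]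
    omega
  rw [derivY, if_pos hs, mulY, if_pos ht, lie_pderiv_mulLeft_X]
  simp only [Sum.inr.injEq, Prod.mk.injEq, hst]

theorem bOp_eq (e : Fin n → Fin n → ℂ) (lam : Fin n → ℂ) (i : Fin n) :
    bOp n e lam i = heisenbergModes derivY mulY (e i) (lam i) := by
  have hP {m : ℤ} (h : 0 < m) : m.toNat.toPNat' = ⟨m.toNat, by omega⟩ :=
    PNat.eq (coe_toNat_toPNat' h)
  funext m
  unfold bOp heisenbergModes
  by_cases h : 0 < m
  · simp only [dif_pos h, if_pos h, derivY, hP h]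
    rfl
  · by_cases h' : m < 0
    · have h'' : 0 < -m := by omega
      simp only [dif_neg h, if_neg h, dif_pos h', if_pos h', mulY, if_pos h'', hP h'']
      rfl
    · simp only [dif_neg h, if_neg h, dif_neg h', if_neg h']

theorem aOp_lie_bOp {r : ℕ} (e : Fin n → Fin n → ℂ) (lam : Fin n → ℂ) (k l i : Fin n) (s t : ℤ) :
    ⁅aOp n r k l s, bOp n e lam i t⁆ = 0 := by
  rw [bOp_eq]
  refine lie_heisenbergModes_eq_zero (lie_derivY_eq_zero fun q => ?_)
    (lie_mulY_eq_zero fun q => ?_) _ _ t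
  all_goals
    unfold aOp
    split_ifs
  · exact lie_pderiv_pderiv _ _
  · simp [lie_mulLeft_X_pderiv]
  · simp [lie_pderiv_mulLeft_X]
  · exact lie_mulLeft_mulLeft _ _

theorem aStar_lie_bOp {r : ℕ} (e : Fin n → Fin n → ℂ) (lam : Fin n → ℂ) (k l i : Fin n)
    (s t : ℤ) : ⁅aStar n r k l s, bOp n e lam i t⁆ = 0 := by
  rw [bOp_eq]
  refine lie_heisenbergModes_eq_zero (lie_derivY_eq_zero fun q => ?_)
    (lie_mulY_eq_zero fun q => ?_) _ _ t
  all_goals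
    unfold aStar
    split_ifs
  · simp [lie_mulLeft_X_pderiv]
  · simp [Ring.neg_bracket, lie_pderiv_pderiv]
  · exact lie_mulLeft_mulLeft _ _
  · simp [Ring.neg_bracket, lie_pderiv_mulLeft_X]

end HeisenbergOnPolynomials

section Realization

variable {n r : ℕ}

/-- The free fields acting on `ℂ[x] ⊗ ℂ[y]`. -/
noncomputable def fockFields (n r : ℕ) (e : Fin n → Fin n → ℂ) (lam : Fin n → ℂ) :
    FreeFields n r (PXY n) where
  a := aOp n r
  s := aStar n r
  b := bOp n e lam
  β i j := ∑ k, e i k * e j k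
  bdd_a _ _ h := bddAboveModes_aOp h
  tame_s := tame_aStar
  bdd_b i := by
    rw [bOp_eq]
    exact bddAboveModes_heisenbergModes bddAboveModes_derivY _ _
  a_lie_a := aOp_lie_aOp
  s_lie_s := aStar_lie_aStar
  a_lie_s := aOp_lie_aStar
  a_lie_b := aOp_lie_bOp e lam
  s_lie_b := aStar_lie_bOp e lam
  b_lie_b i j p q := by
    rw [bOp_eq, bOp_eq]
    exact heisenbergModes_lie derivY_lie_derivY mulY_lie_mulY derivY_lie_mulY _ _ _ _ p q

theorem nord3_eq {A B C : Module.End ℂ (PXY n)} {f₁ f₂ f₃ : Bool} {T : Prop} [Decidable T] {q : ℤ}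
    (hf : f₂ = decide (0 ≤ q ∧ T)) (hAC : ⁅A, C⁆ = 0)
    (hBA : f₁ = false → f₂ = false → ⁅B, A⁆ = 0)
    (hBC : f₂ = true → f₃ = true → ⁅B, C⁆ = 0) :
    nord3 (A, f₁) (B, f₂) (C, f₃) = ordMul T q B (A * C) := by
  rw [Ring.lie_def, sub_eq_zero] at hAC
  simp only [Ring.lie_def, sub_eq_zero] at hBA hBC
  cases f₂
  · rw [ordMul, if_neg (of_decide_eq_false hf.symm)]
    have h : f₁ = false → A * B * C = B * (A * C) := fun hf₁ => by rw [← mul_assoc, hBA hf₁ rfl]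
    cases f₁ <;> cases f₃
    · simpa [nord3, ← mul_assoc] using h rfl
    · simpa [nord3, ← mul_assoc] using h rfl
    · simp [nord3, mul_assoc, hAC]
    · simp [nord3]
  · rw [ordMul, if_pos (of_decide_eq_true hf.symm)]
    have h : f₃ = true → A * (B * C) = A * C * B := fun hf₃ => by rw [hBC rfl hf₃, mul_assoc]
    cases f₁ <;> cases f₃
    · simp [nord3, mul_assoc]
    · simpa [nord3] using h rfl
    · simp [nord3, ← mul_assoc, hAC]
    · simpa [nord3] using h rfl

theorem cubic_eq {i k l : Fin n} {m : ℤ} {P : PXY n} {R : Module.End ℂ (PXY n)}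
    (h : HasOpSum (fun q : ℤ × ℤ => ordMul ((l : ℕ) + 1 ≤ r) q.2 (aOp n r k l q.2)
      (aStar n r i i q.1 * aStar n r k l (m - q.1 - q.2))) R) :
    cubic n r i k l m P = R P := by
  refine (finsum_congr fun q => ?_).trans (h.eq P)
  refine LinearMap.congr_fun (nord3_eq rfl (aStar_lie_aStar _ _ _ _ _ _) (fun h₁ h₂ => ?_)
    fun h₂ h₃ => ?_) P
  · rw [aOp_lie_aStar]
    by_cases hkl : k = i ∧ l = i
    · simp only [annSFlag, Bool.not_eq_false', decide_eq_true_eq,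
        decide_eq_false_iff_not, hkl.2] at h₁ h₂
      rw [if_pos hkl, oneModes, if_neg fun h' => h₂ ⟨by omega, h₁.2⟩]
    · rw [if_neg hkl]
  · simp only [annSFlag, Bool.not_eq_true', decide_eq_true_eq,
      decide_eq_false_iff_not] at h₂ h₃
    rw [aOp_lie_aStar, if_pos ⟨rfl, rfl⟩, oneModes,
      if_neg fun h' => h₃ ⟨by omega, h₂.2⟩]

variable {e : Fin n → Fin n → ℂ} {lam : Fin n → ℂ}

theorem pairOp_eq {k k' l l' : Fin n} (h : l ≤ l') (hne : ¬(k = k' ∧ l = l')) (m : ℤ) (P : PXY n) :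
    pairOp n r k l k' l' m P = (fockFields n r e lam).bil k l k' l' m P :=
  ((fockFields n r e lam).hasOpSum_bil_of_ne h hne m).eq P

open FreeFields

theorem succIdx_eq {i k : Fin n} (h : i < k) :
    succIdx i = ⟨(i : ℕ) + 1, (Nat.succ_le_of_lt (Fin.lt_def.1 h)).trans_lt k.isLt⟩ :=
  Fin.ext (succIdx_val_of_lt h)

theorem sumHigh_eq (i : Fin n) (m : ℤ) (P : PXY n) :
    sumHigh n r i m P = (fockFields n r e lam).high i m P := by
  rw [high_apply]
  refine Finset.sum_congr rfl fun k _ => ?_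
  split_ifs with h
  · rw [succIdx_eq h]
    refine pairOp_eq le_rfl (fun h' => ?_) m P
    have := congrArg Fin.val h'.1
    simp at this
  · rfl

theorem sumLow_eq (i : Fin n) (m : ℤ) (P : PXY n) :
    sumLow n r i m P = (fockFields n r e lam).low i m P := by
  rw [low_apply]
  refine Finset.sum_congr rfl fun k _ => ?_
  split_ifs with h
  · exact pairOp_eq (predIdx_le i) (fun h' => predIdx_ne h h'.2) m P
  · rfl

theorem rhoF_eq (i : Fin n) (m : ℤ) (P : PXY n) :
    rhoF n r i m P = (fockFields n r e lam).lower i m P := by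
  rw [lower_apply]
  refine congrArg (aOp n r i i m P + ·) (Finset.sum_congr rfl fun k _ => ?_)
  split_ifs with h
  · rw [succIdx_eq h]
    refine pairOp_eq le_rfl (fun h' => ?_) m P
    have := congrArg Fin.val h'.1
    simp at this
  · rfl

theorem rhoE_eq (γ : ℂ) (i : Fin n) (m : ℤ) (P : PXY n) :
    rhoE n r γ e lam i m P = (fockFields n r e lam).raise
      ((if r < (i : ℕ) + 1 then (r : ℂ) + 1 else 0)
      + (if (i : ℕ) + 1 ≤ r then ((i : ℕ) : ℂ) + 2 else 0) - γ ^ 2) i m P := by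
  rw [raise_apply]
  refine congrArg₂ (· - ·) (congrArg₂ (· - ·) (congrArg₂ (· - ·) (congrArg₂ (· + ·)
    (congrArg₂ (· - ·) ?_ ?_) (sumHigh_eq i m P)) (sumLow_eq i m P))
    (((fockFields n r e lam).hasOpSum_mul_b i m).eq P)) rfl
  · refine Finset.sum_congr rfl fun k _ => ?_
    split_ifs with h
    · exact cubic_eq ((fockFields n r e lam).hasOpSum_cubic (predIdx_le i) (fun h' => h.ne h'.1) m)
    · rfl
  · refine Finset.sum_congr rfl fun k _ => ?_
    split_ifs with h h'
    · subst h'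
      exact cubic_eq ((fockFields n r e lam).hasOpSum_cubic_self k m)
    · exact cubic_eq ((fockFields n r e lam).hasOpSum_cubic le_rfl (fun hk => h' hk.1) m)
    · rfl

end Realization

theorem apply_comm_of_lie_eq_zero {V : Type*} [AddCommGroup V] [Module ℂ V]
    {A B : Module.End ℂ V} (h : ⁅A, B⁆ = 0) (v : V) : A (B v) = B (A v) :=
  LinearMap.congr_fun (sub_eq_zero.1 h : A * B = B * A) v

/-- R5: if `(α_i|α_j) ≠ −1` then `[ρ(E_i)_m, ρ(E_j)_p] = 0` and
`[ρ(F_i)_m, ρ(F_j)_p] = 0`. -/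
theorem wakimoto_R5 (n r : ℕ) (hn : 1 ≤ n) (hr : r ≤ n)
    (γ : ℂ) (hγ : γ ≠ 0) (e : Fin n → Fin n → ℂ) (lam : Fin n → ℂ)
    (he : ∀ i j, ∑ k, e i k * e j k = Bmat n r γ i j)
    (i j : Fin n) (hij : cartan n i j ≠ -1) (m p : ℤ) (P : PXY n) :
    rhoE n r γ e lam i m (rhoE n r γ e lam j p P)
        - rhoE n r γ e lam j p (rhoE n r γ e lam i m P) = 0 ∧
    rhoF n r i m (rhoF n r j p P) - rhoF n r j p (rhoF n r i m P) = 0 := by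
  have hβ (i j : Fin n) : (fockFields n r e lam).β i j = Bmat n r γ i j := he i j
  have hadj : (i : ℕ) + 1 ≠ j ∧ (j : ℕ) + 1 ≠ i := by
    unfold cartan at hij
    constructor <;> intro h <;> refine hij ?_ <;> rw [if_neg (by rintro rfl; omega), if_pos]
    exacts [Or.inl h, Or.inr h]
  refine ⟨sub_eq_zero.2 ?_, sub_eq_zero.2 ?_⟩
  · simp only [rhoE_eq]
    refine apply_comm_of_lie_eq_zero ?_ P
    rcases eq_or_ne i j with rfl | hne
    · refine (fockFields n r e lam).raise_lie_raise_self i ?_ m p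
      rw [FreeFields.level_self, hβ]
      unfold Bmat cartan
      rcases lt_trichotomy (i : ℕ) r with h | h | h
      · simp [h.le, Nat.succ_le_of_lt h, h.ne, not_lt.2 (Nat.succ_le_of_lt h)]
        ring
      · simp [h]
        ring
      · simp [h.not_ge, h.ne', h.trans (Nat.lt_succ_self _), (h.trans (Nat.lt_succ_self _)).not_ge]
        ring
    · refine (fockFields n r e lam).raise_lie_raise hne hadj.1 hadj.2 ?_ _ _ m p
      rw [hβ, Bmat, cartan, if_neg hne.symm, if_neg (by tauto), Int.cast_zero, zero_mul]
  · simp only [rhoF_eq (e := e) (lam := lam)]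
    exact apply_comm_of_lie_eq_zero ((fockFields n r e lam).lower_lie_lower hadj.1 hadj.2 m p) P
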